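/- arXiv:1702.04608 — 2 statements merged into one kernel-verified Lean document; each statement's English description precedes it below -/
import Mathlib

section
/- Among all trees with a given tree degree sequence, the greedy tree attains the maximal connective eccentricity index; that is, if d̄ = (d₁,…,d_n) is a non-increasing tree degree sequence and T* is the greedy tree for d̄, then ξ^{ce}(T) ≤ ξ^{ce}(T*) for every tree T with degree sequence d̄. -/
open Finset SimpleGraph

variable {V : Type*}

open Classical in
/-- The degree of a vertex `u` in a graph `G` (number of neighbors). -/
noncomputable def deg [Fintype V] (G : SimpleGraph V) (u : V) : ℕ :=
  (Finset.univ.filter (fun v => G.Adj u v)).card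

/-- The eccentricity of a vertex `u`: the maximum distance from `u` to any vertex. -/
noncomputable def ecc [Fintype V] (G : SimpleGraph V) (u : V) : ℕ :=
  Finset.univ.sup (fun v => G.dist u v)

/-- The connective eccentricity index `ξ^{ce}(G) = Σ_{u ∈ V} d(u)/ε(u)`. -/
noncomputable def cei [Fintype V] (G : SimpleGraph V) : ℝ :=
  ∑ u : V, (deg G u : ℝ) / (ecc G u)

/-- `G` has degree sequence `d = (d₁, …, d_n)` (up to relabeling of the vertices). -/
def hasDegSeq [Fintype V] (G : SimpleGraph V) {n : ℕ} (d : Fin n → ℕ) : Prop :=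
  ∃ e : V ≃ Fin n, ∀ v, deg G v = d (e v)

/-- The rooted tree `(T, r)` has level-degree sequence `L`: for each `i`, `L i` is the
multiset of degrees of the vertices at height (distance from the root) `i`. -/
def hasLevelDegSeq [Fintype V] (T : SimpleGraph V) (r : V) (L : ℕ → Multiset ℕ) : Prop :=
  ∀ i : ℕ, L i = ((Finset.univ.filter (fun v => T.dist r v = i)).val.map (deg T))

/-- The rooted tree `(T, r)` is level-greedy: there is a left-to-right ordering `ord`
of the vertices of each level such that within every level the degrees are
non-increasing from left to right, and each vertex of a level joins its children to
the first so-far-unconnected vertices of the next level, i.e. the children of an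
earlier vertex come before the children of a later vertex. -/
def IsLevelGreedy [Fintype V] (T : SimpleGraph V) (r : V) : Prop :=
  ∃ ord : V → ℕ,
    (∀ u v, T.dist r u = T.dist r v → ord u = ord v → u = v) ∧
    (∀ u v, T.dist r u = T.dist r v → ord u ≤ ord v → deg T v ≤ deg T u) ∧
    (∀ p q u v, T.dist r u = T.dist r v →
      T.Adj p u → T.dist r u = T.dist r p + 1 →
      T.Adj q v → T.dist r v = T.dist r q + 1 →
      ord p < ord q → ord u < ord v)

/-- The rooted tree `(T, r)` is the greedy tree for its degree sequence: it is
level-greedy, the root has maximal degree, and every degree occurring at height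
`i + 1` is at most every degree occurring at height `i`. -/
def IsGreedyTree [Fintype V] (T : SimpleGraph V) (r : V) : Prop :=
  IsLevelGreedy T r ∧ (∀ v, deg T v ≤ deg T r) ∧
    (∀ u v : V, T.dist r u = T.dist r v + 1 → deg T u ≤ deg T v)

/-- The level of `u` around the pair `a`, `b`: its distance to the nearer of the two. -/
noncomputable def pairLevel (G : SimpleGraph V) (a b u : V) : ℕ :=
  min (G.dist a u) (G.dist b u)

lemma SimpleGraph.Connected.exists_adj_dist_eq_add_one {G : SimpleGraph V} (hG : G.Connected)
    {r u : V} (h : G.dist r u ≠ 0) : ∃ p, G.Adj p u ∧ G.dist r u = G.dist r p + 1 := by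
  obtain ⟨w, hw⟩ := hG.exists_walk_length_eq_dist u r
  cases w with
  | nil => simp at h
  | @cons _ p _ hup w =>
    refine ⟨p, hup.symm, ?_⟩
    have h1 := dist_le w
    have h2 := hG.dist_triangle (u := u) (v := p) (w := r)
    have h3 := dist_eq_one_iff_adj.2 hup
    rw [dist_comm (u := r) (v := u), dist_comm (u := r) (v := p)]
    simp at hw
    omega

lemma SimpleGraph.IsTree.eq_of_adj_of_dist_eq_add_one {G : SimpleGraph V} (hG : G.IsTree)
    {r u p q : V} (hp : G.Adj p u) (hq : G.Adj q u)
    (hpd : G.dist r u = G.dist r p + 1) (hqd : G.dist r u = G.dist r q + 1) : p = q := by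
  obtain ⟨w, hw⟩ := hG.connected.exists_walk_length_eq_dist r p
  obtain ⟨x, hx⟩ := hG.connected.exists_walk_length_eq_dist r q
  have h1 : (w.concat hp).IsPath := Walk.isPath_of_length_eq_dist _ (by simp [hw, hpd])
  have h2 : (x.concat hq).IsPath := Walk.isPath_of_length_eq_dist _ (by simp [hx, hqd])
  have h3 := (hG.existsUnique_path r u).unique h1 h2
  have h4 := congrArg Walk.penultimate h3
  simpa using h4

/-- If deleting the edge `a v` separates `u` (on the side of `v`) from `w` (on the side of `a`),
then the path from `w` to `u` runs through that edge. -/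
lemma SimpleGraph.IsTree.dist_eq_of_separated {G : SimpleGraph V} (hG : G.IsTree)
    {a v w : V} (hav : G.Adj a v) (hw : G.dist v w = G.dist a w + 1) :
    ∀ (m : ℕ) (u : V), G.dist v u = m → G.dist a u = m + 1 →
      G.dist w u = m + 1 + G.dist a w := by
  intro m
  induction m using Nat.strong_induction_on with
  | _ m ih =>
  intro u hvu hau
  have hwv : G.dist w v = G.dist a w + 1 := by rw [dist_comm, hw]
  rcases m with _ | m
  · rw [← hG.connected.dist_eq_zero_iff.1 hvu]
    omega
  obtain ⟨p, hpu, hp⟩ := hG.connected.exists_adj_dist_eq_add_one (r := v) (u := u) (by omega)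
  have hap1 := hG.connected.dist_triangle (u := a) (v := v) (w := p)
  have hap2 := hG.connected.dist_triangle (u := a) (v := p) (w := u)
  rw [dist_eq_one_iff_adj.2 hav] at hap1
  rw [dist_eq_one_iff_adj.2 hpu] at hap2
  have hwp := ih m (by omega) p (by omega) (by omega)
  rcases hG.dist_eq_dist_add_one_of_adj w hpu with h | h
  · exfalso
    rcases m with _ | m
    · have hpv : v = p := hG.connected.dist_eq_zero_iff.1 (by omega)
      subst hpv
      have hua : u = a := hG.eq_of_adj_of_dist_eq_add_one (r := w) hpu.symm hav h
        (by rw [hwv, dist_comm])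
      subst hua
      simp at hau
    · obtain ⟨q, hqp, hq⟩ := hG.connected.exists_adj_dist_eq_add_one (r := v) (u := p) (by omega)
      have haq1 := hG.connected.dist_triangle (u := a) (v := v) (w := q)
      have haq2 := hG.connected.dist_triangle (u := a) (v := q) (w := p)
      rw [dist_eq_one_iff_adj.2 hav] at haq1
      rw [dist_eq_one_iff_adj.2 hqp] at haq2
      have hwq := ih m (by omega) q (by omega) (by omega)
      have huq : u = q := hG.eq_of_adj_of_dist_eq_add_one (r := w) hpu.symm hqp h (by omega)
      subst huq
      omega
  · omega

lemma dist_le_ecc [Fintype V] (G : SimpleGraph V) (u v : V) : G.dist u v ≤ ecc G u :=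
  Finset.le_sup (f := fun v => G.dist u v) (Finset.mem_univ v)

lemma exists_dist_eq_ecc [Fintype V] (G : SimpleGraph V) (u : V) : ∃ v, G.dist u v = ecc G u := by
  obtain ⟨v, -, hv⟩ := Finset.exists_mem_eq_sup Finset.univ ⟨u, Finset.mem_univ u⟩
    (fun v => G.dist u v)
  exact ⟨v, hv.symm⟩

lemma exists_adj_of_one_le_deg [Fintype V] {G : SimpleGraph V} {u : V} (h : 1 ≤ deg G u) :
    ∃ v, G.Adj u v := by
  classical
  obtain ⟨v, hv⟩ := Finset.card_pos.1 h
  exact ⟨v, (Finset.mem_filter.1 hv).2⟩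

/-- Every tree has a center, a vertex (`a = b`) or an edge, and the eccentricity of a vertex
grows with its distance from the center. -/
lemma SimpleGraph.IsTree.exists_center [Fintype V] {G : SimpleGraph V} (hG : G.IsTree) :
    ∃ a b : V, G.dist a b ≤ 1 ∧ (∀ u, pairLevel G a b u + ecc G a ≤ ecc G u) ∧
      (∀ u, pairLevel G a b u + G.dist a b ≤ ecc G a) := by
  have := hG.connected.nonempty
  obtain ⟨a, ha⟩ := Finite.exists_min (ecc G)
  by_cases hb : ∃ b, G.Adj a b ∧ ecc G b = ecc G a
  · obtain ⟨b, hab, hb⟩ := hb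
    have hab1 := dist_eq_one_iff_adj.2 hab
    -- the far end of a longest path from `x` lies on the side of its central neighbor `y`
    have key : ∀ x y, G.Adj x y → ecc G y = ecc G x → ∀ u, G.dist y u = G.dist x u + 1 →
        G.dist x u + ecc G x ≤ ecc G u := by
      intro x y hxy he u hu
      obtain ⟨w, hw⟩ := exists_dist_eq_ecc G x
      have h1 := dist_le_ecc G y w
      have h2 := hG.dist_eq_dist_add_one_of_adj w hxy
      rw [dist_comm (u := w) (v := x), dist_comm (u := w) (v := y)] at h2
      have h3 := hG.dist_eq_of_separated hxy.symm (w := w) (by omega) _ u rfl hu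
      have h4 := dist_le_ecc G u w
      rw [dist_comm] at h4
      omega
    refine ⟨a, b, hab1.le, fun u => ?_, fun u => ?_⟩
    · have h2 := hG.dist_eq_dist_add_one_of_adj u hab
      rw [dist_comm (u := u) (v := a), dist_comm (u := u) (v := b)] at h2
      unfold pairLevel
      rcases h2 with h2 | h2
      · have := key b a hab.symm hb.symm u h2
        omega
      · have := key a b hab hb u h2
        omega
    · have h2 := hG.dist_ne_of_adj u hab
      rw [dist_comm (u := u) (v := a), dist_comm (u := u) (v := b)] at h2
      have h3 := dist_le_ecc G a u
      have h4 := dist_le_ecc G b u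
      unfold pairLevel
      omega
  · push Not at hb
    refine ⟨a, a, by simp, fun u => ?_, fun u => ?_⟩
    · simp only [pairLevel, min_self]
      by_cases hu : G.dist u a = 0
      · rw [hG.connected.dist_eq_zero_iff.1 hu]
        simp
      obtain ⟨v, hva, hv⟩ := hG.connected.exists_adj_dist_eq_add_one hu
      obtain ⟨w, hw⟩ := exists_dist_eq_ecc G v
      have h1 := hb v hva.symm
      have h2 := ha v
      have h3 := dist_le_ecc G a w
      have h4 := hG.dist_eq_dist_add_one_of_adj w hva
      rw [dist_comm (u := w) (v := a), dist_comm (u := w) (v := v)] at h4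
      rw [dist_comm (u := u) (v := a), dist_comm (u := u) (v := v)] at hv
      have h5 := hG.dist_eq_of_separated hva.symm (w := w) (by omega) _ u rfl hv
      have h6 := dist_le_ecc G u w
      rw [dist_comm] at h6
      omega
    · simpa [pairLevel] using dist_le_ecc G a u

/-- Every vertex above level zero has exactly one neighbor one level below, its other neighbors
being one level above. -/
lemma SimpleGraph.IsTree.exists_parent_pairLevel {G : SimpleGraph V} (hG : G.IsTree) {a b u : V}
    (hab : G.dist a b ≤ 1) (hu : pairLevel G a b u ≠ 0) :
    ∃ p, G.Adj u p ∧ pairLevel G a b u = pairLevel G a b p + 1 ∧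
      ∀ v, G.Adj u v → v ≠ p → pairLevel G a b v = pairLevel G a b u + 1 := by
  wlog h : G.dist a u ≤ G.dist b u generalizing a b
  · have := this (a := b) (b := a) (by rwa [dist_comm]) (by rwa [pairLevel, min_comm]) (by omega)
    simpa only [pairLevel, min_comm (G.dist b _)] using this
  unfold pairLevel at *
  obtain ⟨p, hpu, hp⟩ := hG.connected.exists_adj_dist_eq_add_one (r := a) (u := u) (by omega)
  have hbp : G.dist b u = G.dist b p + 1 := by
    have h1 := hG.dist_eq_dist_add_one_of_adj b hpu
    have h2 := hG.connected.dist_triangle (u := b) (v := a) (w := p)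
    rw [dist_comm (u := b) (v := a)] at h2
    by_cases h0 : G.dist a b = 0
    · rw [← hG.connected.dist_eq_zero_iff.1 h0]
      exact hp
    · have h3 := hG.dist_ne_of_adj u (dist_eq_one_iff_adj.1 (show G.dist a b = 1 by omega))
      rw [dist_comm (u := u) (v := a), dist_comm (u := u) (v := b)] at h3
      omega
  refine ⟨p, hpu.symm, by omega, fun v huv hvp => ?_⟩
  have h1 := hG.dist_eq_dist_add_one_of_adj a huv
  have h2 := hG.dist_eq_dist_add_one_of_adj b huv
  have h3 : G.dist a u ≠ G.dist a v + 1 := fun h' =>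
    hvp (hG.eq_of_adj_of_dist_eq_add_one huv.symm hpu h' hp)
  have h4 : G.dist b u ≠ G.dist b v + 1 := fun h' =>
    hvp (hG.eq_of_adj_of_dist_eq_add_one huv.symm hpu h' hbp)
  omega

lemma SimpleGraph.Connected.pairLevel_eq_zero_iff {G : SimpleGraph V} (hG : G.Connected)
    {a b u : V} : pairLevel G a b u = 0 ↔ u = a ∨ u = b := by
  unfold pairLevel
  rw [Nat.min_eq_zero_iff, hG.dist_eq_zero_iff, hG.dist_eq_zero_iff]
  tauto

lemma SimpleGraph.Connected.pairLevel_le_succ_of_adj {G : SimpleGraph V} (hG : G.Connected)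
    {a b u v : V} (huv : G.Adj u v) : pairLevel G a b v ≤ pairLevel G a b u + 1 := by
  have h1 := hG.dist_triangle (u := a) (v := u) (w := v)
  have h2 := hG.dist_triangle (u := b) (v := u) (w := v)
  rw [dist_eq_one_iff_adj.2 huv] at h1 h2
  unfold pairLevel
  omega

open Classical in
lemma SimpleGraph.IsTree.card_filter_pairLevel_eq_zero [Fintype V] {G : SimpleGraph V}
    (hG : G.IsTree) {a b : V} (hab : G.dist a b ≤ 1) :
    #{u | pairLevel G a b u = 0} = 1 + G.dist a b := by
  have h : ({u | pairLevel G a b u = 0} : Finset V) = {a, b} := by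
    ext u
    simp [hG.connected.pairLevel_eq_zero_iff]
  rw [h]
  by_cases h0 : G.dist a b = 0
  · rw [h0, hG.connected.dist_eq_zero_iff.1 h0]
    simp
  · have hne : a ≠ b := fun h => h0 (hG.connected.dist_eq_zero_iff.2 h)
    rw [Finset.card_pair hne]
    omega

open Classical in
/-- The number of neighbors one level up, for a vertex above level zero. -/
lemma SimpleGraph.IsTree.card_children_of_ne_zero [Fintype V] {G : SimpleGraph V}
    (hG : G.IsTree) {a b u : V} (hab : G.dist a b ≤ 1) (hu : pairLevel G a b u ≠ 0) :
    #{v | G.Adj u v ∧ pairLevel G a b v = pairLevel G a b u + 1} + 1 = deg G u := by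
  obtain ⟨p, hup, hp, hother⟩ := hG.exists_parent_pairLevel hab hu
  have h : ({v | G.Adj u v ∧ pairLevel G a b v = pairLevel G a b u + 1} : Finset V)
      = ({v | G.Adj u v} : Finset V).erase p := by
    ext v
    simp only [mem_filter, mem_univ, true_and, mem_erase]
    constructor
    · rintro ⟨h1, h2⟩
      refine ⟨?_, h1⟩
      rintro rfl
      omega
    · rintro ⟨h1, h2⟩
      exact ⟨h2, hother v h2 h1⟩
  rw [h, Finset.card_erase_add_one (by simpa using hup)]
  rfl

open Classical in
/-- The number of neighbors one level up, for a vertex at level zero. -/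
lemma SimpleGraph.IsTree.card_children_of_eq_zero [Fintype V] {G : SimpleGraph V}
    (hG : G.IsTree) {a b u : V} (hab : G.dist a b ≤ 1) (hu : pairLevel G a b u = 0) :
    #{v | G.Adj u v ∧ pairLevel G a b v = pairLevel G a b u + 1} + G.dist a b = deg G u := by
  have hsub : ∀ v, G.Adj u v → (pairLevel G a b v = pairLevel G a b u + 1 ↔ v ≠ a ∧ v ≠ b) := by
    intro v huv
    have h1 := hG.connected.pairLevel_le_succ_of_adj (a := a) (b := b) huv
    have h2 := hG.connected.pairLevel_eq_zero_iff (a := a) (b := b) (u := v)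
    constructor
    · intro h3
      rw [← not_or, ← h2]
      omega
    · intro h3
      rw [← not_or, ← h2] at h3
      omega
  rw [deg, ← Finset.card_filter_add_card_filter_not (s := {v | G.Adj u v})
    (fun v => pairLevel G a b v = pairLevel G a b u + 1), Finset.filter_filter]
  congr 1
  have h : Finset.filter (fun v => ¬ pairLevel G a b v = pairLevel G a b u + 1)
      {v | G.Adj u v} = Finset.univ.filter (fun v => G.Adj u v ∧ (v = a ∨ v = b)) := by
    ext v
    simp only [mem_filter, mem_univ, true_and]
    constructor
    · rintro ⟨h1, h2⟩
      rw [hsub v h1] at h2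
      exact ⟨h1, by tauto⟩
    · rintro ⟨h1, h2⟩
      rw [hsub v h1]
      exact ⟨h1, by tauto⟩
  rw [h]
  have huab := hG.connected.pairLevel_eq_zero_iff.1 hu
  by_cases h0 : G.dist a b = 0
  · have hab' := hG.connected.dist_eq_zero_iff.1 h0
    subst hab'
    rw [h0, eq_comm, Finset.card_eq_zero, Finset.filter_eq_empty_iff]
    rintro v - ⟨h1, h2⟩
    have h3 := h1.ne
    grind
  · have h1 : G.dist a b = 1 := by omega
    have hadj := dist_eq_one_iff_adj.1 h1
    rw [h1, eq_comm, Finset.card_eq_one]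
    rcases huab with rfl | rfl
    · refine ⟨b, ?_⟩
      ext v
      simp only [mem_filter, mem_univ, true_and, mem_singleton]
      constructor
      · rintro ⟨h2, h3 | h3⟩
        · exact absurd h3.symm h2.ne
        · exact h3
      · rintro rfl
        exact ⟨hadj, Or.inr rfl⟩
    · refine ⟨a, ?_⟩
      ext v
      simp only [mem_filter, mem_univ, true_and, mem_singleton]
      constructor
      · rintro ⟨h2, h3 | h3⟩
        · exact h3
        · exact absurd h3.symm h2.ne
      · rintro rfl
        exact ⟨hadj.symm, Or.inl rfl⟩

open Classical in
lemma SimpleGraph.IsTree.sum_card_children [Fintype V] {G : SimpleGraph V}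
    (hG : G.IsTree) {a b : V} (hab : G.dist a b ≤ 1) (j : ℕ) :
    ∑ u with pairLevel G a b u ≤ j,
      #{v | G.Adj u v ∧ pairLevel G a b v = pairLevel G a b u + 1}
      + #{u | pairLevel G a b u = 0} = #{u | pairLevel G a b u ≤ j + 1} := by
  have h1 := Finset.sum_card_bipartiteAbove_eq_sum_card_bipartiteBelow
    (s := ({u | pairLevel G a b u ≤ j} : Finset V)) (t := Finset.univ)
    (fun u v => G.Adj u v ∧ pairLevel G a b v = pairLevel G a b u + 1)
  have h2 : ∀ v, #(Finset.bipartiteBelow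
      (fun u v => G.Adj u v ∧ pairLevel G a b v = pairLevel G a b u + 1)
      ({u | pairLevel G a b u ≤ j} : Finset V) v)
      = if pairLevel G a b v ≤ j + 1 ∧ pairLevel G a b v ≠ 0 then 1 else 0 := by
    intro v
    split_ifs with hv
    · obtain ⟨p, hvp, hp, hother⟩ := hG.exists_parent_pairLevel hab hv.2
      rw [Finset.card_eq_one]
      refine ⟨p, ?_⟩
      ext u
      simp only [Finset.mem_bipartiteBelow, mem_filter, mem_univ, true_and, mem_singleton]
      constructor
      · rintro ⟨h3, h4, h5⟩
        by_contra hne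
        have := hother u h4.symm hne
        omega
      · rintro rfl
        exact ⟨by omega, hvp.symm, hp⟩
    · rw [Finset.card_eq_zero, Finset.eq_empty_iff_forall_notMem]
      intro u
      simp only [Finset.mem_bipartiteBelow, mem_filter, mem_univ, true_and]
      rintro ⟨h3, h4, h5⟩
      omega
  rw [Finset.sum_congr rfl (fun v _ => h2 v), ← Finset.card_filter] at h1
  have h3 := Finset.card_filter_add_card_filter_not (s := ({u | pairLevel G a b u ≤ j + 1}
    : Finset V)) (fun u => pairLevel G a b u ≠ 0)
  rw [Finset.filter_filter, Finset.filter_filter] at h3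
  have h4 : Finset.univ.filter (fun u => pairLevel G a b u ≤ j + 1 ∧ ¬ pairLevel G a b u ≠ 0)
      = Finset.univ.filter (fun u => pairLevel G a b u = 0) :=
    Finset.filter_congr fun u _ => by omega
  rw [h4, ← h1] at h3
  exact h3

/-- The size of a ball around the pair is determined by the degrees in the next smaller ball. -/
lemma SimpleGraph.IsTree.card_pairLevel_le_succ [Fintype V] {G : SimpleGraph V}
    (hG : G.IsTree) {a b : V} (hab : G.dist a b ≤ 1) (j : ℕ) :
    #{u | pairLevel G a b u ≤ j + 1} + #{u | pairLevel G a b u ≤ j}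
      = ∑ u with pairLevel G a b u ≤ j, deg G u + 2 := by
  classical
  have h0 := hG.card_filter_pairLevel_eq_zero hab
  have h1 := hG.sum_card_children hab j
  have h2 : ∀ u, deg G u + (if pairLevel G a b u = 0 then 1 else 0)
      = #{v | G.Adj u v ∧ pairLevel G a b v = pairLevel G a b u + 1} + 1
        + (if pairLevel G a b u = 0 then G.dist a b else 0) := by
    intro u
    split_ifs with hu
    · have := hG.card_children_of_eq_zero hab hu
      omega
    · have := hG.card_children_of_ne_zero hab hu
      omega
  have h3 := Finset.sum_congr (s₁ := ({u | pairLevel G a b u ≤ j} : Finset V)) rfl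
    (fun u _ => h2 u)
  simp only [Finset.sum_add_distrib, ← Finset.sum_filter, Finset.sum_const, smul_eq_mul,
    mul_one, Finset.filter_filter] at h3
  have h4 : Finset.univ.filter (fun u => pairLevel G a b u ≤ j ∧ pairLevel G a b u = 0)
      = Finset.univ.filter (fun u => pairLevel G a b u = 0) :=
    Finset.filter_congr fun u _ => by omega
  rw [h4, h0] at h3
  rw [h0] at h1
  have h5 : G.dist a b = 0 ∨ G.dist a b = 1 := by omega
  rcases h5 with h5 | h5 <;> rw [h5] at h1 h3 <;> omega

/-- A set of `g`-largest elements has the largest `g`-sum among sets that are not bigger. -/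
lemma sum_le_sum_of_forall_notMem_le {W : Type*} {A B : Finset W} (g : W → ℕ) (hAB : #A ≤ #B)
    (htop : ∀ u ∈ B, ∀ v ∉ B, g v ≤ g u) : ∑ u ∈ A, g u ≤ ∑ u ∈ B, g u := by
  classical
  rw [← Finset.sum_inter_add_sum_sdiff A B, ← Finset.sum_inter_add_sum_sdiff B A,
    Finset.inter_comm B A]
  refine Nat.add_le_add_left ?_ _
  have hcard : #(A \ B) ≤ #(B \ A) := by
    have h1 := Finset.card_sdiff_add_card_inter A B
    have h2 := Finset.card_sdiff_add_card_inter B A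
    rw [Finset.inter_comm B A] at h2
    omega
  set m := (A \ B).sup g
  calc ∑ u ∈ A \ B, g u ≤ #(A \ B) * m := by
        simpa using Finset.sum_le_card_nsmul (A \ B) g m (fun u hu => Finset.le_sup hu)
    _ ≤ #(B \ A) * m := Nat.mul_le_mul_right _ hcard
    _ ≤ ∑ u ∈ B \ A, g u := by
        simpa using Finset.card_nsmul_le_sum (B \ A) g m (fun u hu => Finset.sup_le fun v hv =>
          htop u (Finset.mem_sdiff.1 hu).1 v (Finset.mem_sdiff.1 hv).2)

lemma sum_comp_le_sum_of_forall_notMem_le {W : Type*} (e : V ≃ W) {A : Finset V} {B : Finset W}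
    (g : W → ℕ) (hAB : #A ≤ #B) (htop : ∀ u ∈ B, ∀ v ∉ B, g v ≤ g u) :
    ∑ u ∈ A, g (e u) ≤ ∑ u ∈ B, g u := by
  have := sum_le_sum_of_forall_notMem_le (A := A.map e.toEmbedding) g (by simpa using hAB) htop
  simpa using this

section Comparison

variable {W : Type*} [Fintype V] [Fintype W] {G : SimpleGraph V} {H : SimpleGraph W}
  {a b : V} {r s : W}

/-- If the degrees of `H` decrease with the level, then the balls of `H` are the largest among
trees with the same degrees. -/
lemma SimpleGraph.IsTree.card_pairLevel_le (hG : G.IsTree) (hH : H.IsTree)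
    (e : V ≃ W) (he : ∀ v, deg G v = deg H (e v)) (hpos : ∀ w, 1 ≤ deg H w)
    (hab : G.dist a b ≤ 1) (hrs : H.dist r s = G.dist a b)
    (htop : ∀ u v, pairLevel H r s u < pairLevel H r s v → deg H v ≤ deg H u) (j : ℕ) :
    #{u | pairLevel G a b u ≤ j} ≤ #{w | pairLevel H r s w ≤ j} := by
  induction j with
  | zero =>
    simp only [Nat.le_zero]
    rw [hG.card_filter_pairLevel_eq_zero hab, hH.card_filter_pairLevel_eq_zero (by omega), hrs]
  | succ j ih =>
    have h1 := hG.card_pairLevel_le_succ hab j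
    have h2 := hH.card_pairLevel_le_succ (a := r) (b := s) (by omega) j
    have h3 := sum_comp_le_sum_of_forall_notMem_le e (fun w => deg H w - 1) ih
      (fun u hu v hv => by
        have := htop u v (by simp at hu hv; omega)
        omega)
    have h4 : ∑ u with pairLevel G a b u ≤ j, deg G u
        = ∑ u with pairLevel G a b u ≤ j, (deg H (e u) - 1) + #{u | pairLevel G a b u ≤ j} := by
      rw [Finset.card_eq_sum_ones, ← Finset.sum_add_distrib]
      refine Finset.sum_congr rfl fun u _ => ?_
      have := hpos (e u)
      rw [he]
      omega
    have h5 : ∑ w with pairLevel H r s w ≤ j, deg H w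
        = ∑ w with pairLevel H r s w ≤ j, (deg H w - 1) + #{w | pairLevel H r s w ≤ j} := by
      rw [Finset.card_eq_sum_ones, ← Finset.sum_add_distrib]
      refine Finset.sum_congr rfl fun u _ => ?_
      have := hpos u
      omega
    omega

lemma SimpleGraph.IsTree.sum_deg_pairLevel_le (hG : G.IsTree) (hH : H.IsTree)
    (e : V ≃ W) (he : ∀ v, deg G v = deg H (e v)) (hpos : ∀ w, 1 ≤ deg H w)
    (hab : G.dist a b ≤ 1) (hrs : H.dist r s = G.dist a b)
    (htop : ∀ u v, pairLevel H r s u < pairLevel H r s v → deg H v ≤ deg H u) (j : ℕ) :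
    ∑ u with pairLevel G a b u ≤ j, deg G u ≤ ∑ w with pairLevel H r s w ≤ j, deg H w := by
  simp only [he]
  exact sum_comp_le_sum_of_forall_notMem_le e (deg H)
    (hG.card_pairLevel_le hH e he hpos hab hrs htop j)
    (fun u hu v hv => htop u v (by simp at hu hv; omega))

end Comparison

/-- Summation by parts of a weighted sum of values of `f`, grouped by sublevel sets. -/
lemma sum_mul_eq_sum_range_sublevel [Fintype V] (f : ℕ → ℝ) (x l : V → ℕ) {N : ℕ}
    (hl : ∀ v, l v ≤ N) :
    ∑ v, (x v : ℝ) * f (l v) = ((∑ v, x v : ℕ) : ℝ) * f N + ∑ j ∈ Finset.range N,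
      (f j - f (j + 1)) * ((∑ v with l v ≤ j, x v : ℕ) : ℝ) := by
  have htel : ∀ i k, i ≤ k → f i = f k + ∑ j ∈ Finset.range k,
      (f j - f (j + 1)) * (if i ≤ j then 1 else 0) := by
    intro i k hik
    induction k, hik using Nat.le_induction with
    | base =>
      rw [Finset.sum_eq_zero, add_zero]
      intro j hj
      rw [Finset.mem_range] at hj
      rw [if_neg (by omega), mul_zero]
    | succ k hk ih =>
      rw [Finset.sum_range_succ, if_pos hk, ih]
      ring
  simp only [Nat.cast_sum, Finset.sum_mul, Finset.mul_sum, Finset.sum_filter]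
  rw [Finset.sum_comm, ← Finset.sum_add_distrib]
  refine Finset.sum_congr rfl fun v _ => ?_
  rw [htel (l v) N (hl v), mul_add, Finset.mul_sum]
  congr 1
  refine Finset.sum_congr rfl fun j _ => ?_
  split_ifs <;> push_cast <;> ring

/-- A weight concentrated on smaller values gives a larger sum against an antitone function. -/
lemma sum_mul_le_sum_mul_of_antitone {W : Type*} [Fintype V] [Fintype W] {f : ℕ → ℝ}
    (hf : Antitone f) (x l : V → ℕ) (y m : W → ℕ) (htot : ∑ v, x v = ∑ w, y w)
    (h : ∀ j, ∑ v with l v ≤ j, x v ≤ ∑ w with m w ≤ j, y w) :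
    ∑ v, (x v : ℝ) * f (l v) ≤ ∑ w, (y w : ℝ) * f (m w) := by
  have hl : ∀ v, l v ≤ Finset.univ.sup l + Finset.univ.sup m := fun v =>
    (Finset.le_sup (f := l) (Finset.mem_univ v)).trans (Nat.le_add_right _ _)
  have hm : ∀ w, m w ≤ Finset.univ.sup l + Finset.univ.sup m := fun w =>
    (Finset.le_sup (f := m) (Finset.mem_univ w)).trans (Nat.le_add_left _ _)
  rw [sum_mul_eq_sum_range_sublevel f x l hl, sum_mul_eq_sum_range_sublevel f y m hm, htot]
  gcongr with j hj
  · exact sub_nonneg.2 (hf (Nat.le_succ j))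
  · exact h j

/-- In a greedy tree, degrees weakly decrease with the height. -/
lemma IsGreedyTree.deg_le_of_dist_lt [Fintype V] {G : SimpleGraph V} {r : V} (hG : G.IsTree)
    (hg : IsGreedyTree G r) {u v : V} (huv : G.dist r u < G.dist r v) : deg G v ≤ deg G u := by
  obtain ⟨k, hk⟩ := Nat.exists_eq_add_of_lt huv
  induction k generalizing v with
  | zero => exact hg.2.2 v u hk
  | succ k ih =>
    obtain ⟨p, -, hp⟩ := hG.connected.exists_adj_dist_eq_add_one (r := r) (u := v) (by omega)
    exact (hg.2.2 v p hp).trans (ih (by omega) (by omega))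

/-- A greedy tree is also greedy when rooted at the edge joining the root to its leftmost child. -/
lemma IsGreedyTree.exists_child_deg_le [Fintype V] {G : SimpleGraph V} {r : V} (hG : G.IsTree)
    (hg : IsGreedyTree G r) (hr : 1 ≤ deg G r) :
    ∃ s, G.dist r s = 1 ∧
      ∀ u v, pairLevel G r s u < pairLevel G r s v → deg G v ≤ deg G u := by
  classical
  obtain ⟨ord, hinj, hdeg, hord⟩ := hg.1
  obtain ⟨t, ht⟩ := exists_adj_of_one_le_deg hr
  obtain ⟨s, hs, hmin⟩ := Finset.exists_min_image {v | G.Adj r v} ord ⟨t, by simpa using ht⟩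
  simp only [mem_filter, mem_univ, true_and] at hs hmin
  have hside : ∀ u, G.dist r u = G.dist s u + 1 ∨ G.dist s u = G.dist r u + 1 := fun u => by
    have := hG.dist_eq_dist_add_one_of_adj u hs
    rwa [dist_comm (u := u) (v := r), dist_comm (u := u) (v := s)] at this
  have hleft : ∀ k u v, G.dist r u = k + 1 → G.dist r v = k + 1 → G.dist r u = G.dist s u + 1 →
      G.dist s v = G.dist r v + 1 → ord u < ord v := by
    intro k
    induction k with
    | zero =>
      intro u v hu hv hsu hsv
      have h1 : s = u := hG.connected.dist_eq_zero_iff.1 (by omega)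
      subst h1
      refine lt_of_le_of_ne (hmin v (dist_eq_one_iff_adj.1 hv)) fun h => ?_
      rw [← hinj s v (by omega) h] at hsv
      simp at hsv
    | succ k ih =>
      intro u v hu hv hsu hsv
      obtain ⟨p, hpu, hp⟩ := hG.connected.exists_adj_dist_eq_add_one (r := s) (u := u) (by omega)
      obtain ⟨q, hqv, hq⟩ := hG.connected.exists_adj_dist_eq_add_one (r := r) (u := v) (by omega)
      have h1 := hside p
      have h2 := hside q
      have h3 := hG.dist_eq_dist_add_one_of_adj r hpu
      have h4 := hG.dist_eq_dist_add_one_of_adj s hqv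
      exact hord p q u v (by omega) hpu (by omega) hqv hq
        (ih p q (by omega) (by omega) (by omega) (by omega))
  refine ⟨s, dist_eq_one_iff_adj.2 hs, fun u v huv => ?_⟩
  by_cases hlt : G.dist r u < G.dist r v
  · exact hg.deg_le_of_dist_lt hG hlt
  have h1 := hside u
  have h2 := hside v
  unfold pairLevel at huv
  exact hdeg u v (by omega)
    (hleft (G.dist s u) u v (by omega) (by omega) (by omega) (by omega)).le

lemma ecc_le_pairLevel_add [Fintype V] {G : SimpleGraph V} (hG : G.Connected) {a b : V} {R : ℕ}
    (h : ∀ v, pairLevel G a b v + G.dist a b ≤ R) (u : V) : ecc G u ≤ pairLevel G a b u + R := by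
  refine Finset.sup_le fun v _ => ?_
  have hv := h v
  have h1 := hG.dist_triangle (u := u) (v := a) (w := v)
  have h2 := hG.dist_triangle (u := u) (v := b) (w := v)
  have h3 := hG.dist_triangle (u := u) (v := a) (w := b)
  have h4 := hG.dist_triangle (u := u) (v := b) (w := a)
  rw [dist_comm (u := u) (v := a)] at *
  rw [dist_comm (u := u) (v := b)] at *
  rw [dist_comm (u := b) (v := a)] at h4
  unfold pairLevel at *
  omega

/-- among all trees with a given (non-increasing) tree degree sequence,
the greedy tree attains the maximal connective eccentricity index. -/
theorem cei_greedyTree_max {n : ℕ} (d : Fin n → ℕ)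
    (hpos : ∀ i, 1 ≤ d i) (hmono : ∀ i j : Fin n, i ≤ j → d j ≤ d i)
    (hsum : ∑ i, d i = 2 * (n - 1))
    {W : Type*} [Fintype V] [Fintype W]
    (Tstar : SimpleGraph W) (rstar : W) (hTstar : Tstar.IsTree)
    (hdstar : hasDegSeq Tstar d) (hgreedy : IsGreedyTree Tstar rstar)
    (T : SimpleGraph V) (hT : T.IsTree) (hd : hasDegSeq T d) :
    cei T ≤ cei Tstar := by
  obtain ⟨e₁, he₁⟩ := hd
  obtain ⟨e₂, he₂⟩ := hdstar
  have he : ∀ v, deg T v = deg Tstar ((e₁.trans e₂.symm) v) := fun v => by simp [he₁, he₂]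
  generalize e₁.trans e₂.symm = e at he
  have hposstar : ∀ w, 1 ≤ deg Tstar w := fun w => by
    rw [he₂]
    exact hpos _
  obtain ⟨a, b, hab, hecc, hlevel⟩ := hT.exists_center
  have hR : 0 < ecc T a := by
    obtain ⟨v, hv⟩ := exists_adj_of_one_le_deg (G := T) (u := a) (by rw [he]; exact hposstar _)
    have := dist_le_ecc T a v
    rw [dist_eq_one_iff_adj.2 hv] at this
    omega
  obtain ⟨s, hs, htop⟩ : ∃ s, Tstar.dist rstar s = T.dist a b ∧
      ∀ u v, pairLevel Tstar rstar s u < pairLevel Tstar rstar s v →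
        deg Tstar v ≤ deg Tstar u := by
    by_cases h0 : T.dist a b = 0
    · refine ⟨rstar, by simp [h0], fun u v huv => ?_⟩
      simp only [pairLevel, min_self] at huv
      exact hgreedy.deg_le_of_dist_lt hTstar huv
    · rw [show T.dist a b = 1 by omega]
      exact hgreedy.exists_child_deg_le hTstar (hposstar _)
  have hlevelstar : ∀ w, pairLevel Tstar rstar s w + Tstar.dist rstar s ≤ ecc T a := by
    intro w
    have hRab : T.dist a b ≤ ecc T a := dist_le_ecc T a b
    have h1 := hT.card_pairLevel_le hTstar e he hposstar hab hs htop (ecc T a - T.dist a b)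
    have h2 : Finset.univ.filter (fun u => pairLevel T a b u ≤ ecc T a - T.dist a b)
        = Finset.univ :=
      Finset.filter_true_of_mem fun u _ => by have := hlevel u; omega
    rw [h2, Finset.card_univ, Fintype.card_congr e, ← Finset.card_univ] at h1
    have h3 := (Finset.card_filter_eq_iff.1 (le_antisymm (Finset.card_filter_le _ _) h1))
      w (Finset.mem_univ w)
    omega
  have heccstar := ecc_le_pairLevel_add hTstar.connected hlevelstar
  have heccpos : ∀ w, 0 < ecc Tstar w := by
    intro w
    obtain ⟨v, hv⟩ := exists_adj_of_one_le_deg (hposstar w)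
    have := dist_le_ecc Tstar w v
    rw [dist_eq_one_iff_adj.2 hv] at this
    omega
  have hanti : Antitone fun k : ℕ => (1 : ℝ) / ((k + ecc T a : ℕ) : ℝ) := by
    intro i j hij
    have : 0 < i + ecc T a := by omega
    dsimp only
    gcongr
  calc cei T ≤ ∑ u, (deg T u : ℝ) * (1 / ((pairLevel T a b u + ecc T a : ℕ) : ℝ)) := by
        refine Finset.sum_le_sum fun u _ => ?_
        have : 0 < pairLevel T a b u + ecc T a := by omega
        rw [mul_one_div]
        have := hecc u
        gcongr
    _ ≤ ∑ w, (deg Tstar w : ℝ) * (1 / ((pairLevel Tstar rstar s w + ecc T a : ℕ) : ℝ)) :=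
        sum_mul_le_sum_mul_of_antitone hanti _ _ _ _
          (by simp only [he]; exact Equiv.sum_comp e (deg Tstar))
          (hT.sum_deg_pairLevel_le hTstar e he hposstar hab hs htop)
    _ ≤ cei Tstar := by
        refine Finset.sum_le_sum fun w _ => ?_
        rw [mul_one_div]
        have := heccpos w
        have := heccstar w
        gcongr
end

section
/- Let T be a tree with n vertices and exactly r branching vertices, where 1 ≤ r ≤ n/2 − 1. Then ξ^{ce}(T) ≥ ξ^{ce}(F(n,r)), with equality if and only if T ≅ F(n,r). -/
open Finset SimpleGraph

variable {V : Type*}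

/-- The number of branching vertices (vertices of degree at least 3) of `T`. -/
noncomputable def branchCount [Fintype V] (T : SimpleGraph V) : ℕ :=
  (Finset.univ.filter (fun v => 3 ≤ deg T v)).card

/-- `T` is a greedy caterpillar whose spine has `k` vertices. -/
def IsGreedyCaterpillar [Fintype V] (T : SimpleGraph V) (k : ℕ) : Prop :=
  ∃ z : Fin k ↪ V,
    (∀ (i : ℕ) (h : i + 1 < k), T.Adj (z ⟨i, Nat.lt_of_succ_lt h⟩) (z ⟨i + 1, h⟩)) ∧
    (∀ v, v ∉ Set.range z → deg T v = 1) ∧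
    (∀ i : Fin k, 2 ≤ deg T (z i)) ∧
    (∀ i j : Fin k,
      max (j : ℕ) (k - 1 - (j : ℕ)) < max (i : ℕ) (k - 1 - (i : ℕ)) →
      deg T (z j) ≤ deg T (z i))

/-- The degree sequence of `F(n,r)`: `r` threes, `n - 2r - 2` twos and `r + 2` ones. -/
def dF (n r : ℕ) : Fin n → ℕ := fun i =>
  if (i : ℕ) < r then 3 else if (i : ℕ) < n - r - 2 then 2 else 1

/-! ### Distances in trees -/

/-- Of two distinct neighbours of a vertex `c` of a tree, at most one is closer than `c` to a
given vertex `v`. -/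
theorem SimpleGraph.IsTree.dist_eq_add_one_or {T : SimpleGraph V} (hT : T.IsTree) {a b c : V}
    (ha : T.Adj c a) (hb : T.Adj c b) (hab : a ≠ b) (v : V) :
    T.dist v a = T.dist v c + 1 ∨ T.dist v b = T.dist v c + 1 := by
  by_contra! h
  have closer : ∀ {x}, T.Adj c x → T.dist v x ≠ T.dist v c + 1 →
      ∃ w : T.Walk v c, w.IsPath ∧ w.penultimate = x := by
    intro x hx hne
    have h₁ : T.dist v c = T.dist v x + 1 := by
      rcases hT.dist_eq_dist_add_one_of_adj v hx with h | h
      · exact h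
      · exact absurd h hne
    obtain ⟨w, hw⟩ := hT.connected.exists_walk_length_eq_dist v x
    refine ⟨w.concat hx.symm, Walk.isPath_of_length_eq_dist _ ?_, by simp⟩
    rw [Walk.length_concat, hw, h₁]
  obtain ⟨w₁, hw₁, rfl⟩ := closer ha h.1
  obtain ⟨w₂, hw₂, rfl⟩ := closer hb h.2
  exact hab ((hT.existsUnique_path v c).unique hw₁ hw₂ ▸ rfl)

/-- `p 0, …, p D` is a shortest path of length `D`. -/
structure IsGeodesic (T : SimpleGraph V) (D : ℕ) (p : ℕ → V) : Prop where
  adj : ∀ i < D, T.Adj (p i) (p (i + 1))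
  dist_ends : T.dist (p 0) (p D) = D

/-- `p 0, …, p D` is a shortest path of length `D`, and `D` is the diameter. -/
structure IsDiametral (T : SimpleGraph V) (D : ℕ) (p : ℕ → V) : Prop extends
    IsGeodesic T D p where
  dist_le : ∀ u v, T.dist u v ≤ D

section Geodesic

variable {T : SimpleGraph V} {D : ℕ} {p : ℕ → V}

theorem dist_le_of_adj_succ (hT : T.Connected) (h : ∀ i < D, T.Adj (p i) (p (i + 1)))
    {i j : ℕ} (hij : i ≤ j) (hj : j ≤ D) : T.dist (p i) (p j) ≤ j - i := by
  induction j, hij using Nat.le_induction with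
  | base => simp
  | succ j hij ih =>
    have h₁ := hT.dist_triangle (u := p i) (v := p j) (w := p (j + 1))
    have h₂ := dist_eq_one_iff_adj.2 (h j hj)
    have := ih (by omega)
    omega

theorem IsGeodesic.dist_eq (hT : T.Connected) (hp : IsGeodesic T D p) {i j : ℕ} (hij : i ≤ j)
    (hj : j ≤ D) : T.dist (p i) (p j) = j - i := by
  have h₁ := dist_le_of_adj_succ hT hp.adj hij hj
  have h₂ := dist_le_of_adj_succ hT hp.adj (Nat.zero_le i) (hij.trans hj)
  have h₃ := dist_le_of_adj_succ hT hp.adj hj le_rfl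
  have h₄ := hT.dist_triangle (u := p 0) (v := p i) (w := p D)
  have h₅ := hT.dist_triangle (u := p i) (v := p j) (w := p D)
  have := hp.dist_ends
  omega

theorem IsGeodesic.injOn (hT : T.Connected) (hp : IsGeodesic T D p) :
    Set.InjOn p (Set.Iic D) := by
  intro i hi j hj h
  simp only [Set.mem_Iic] at hi hj
  rcases le_total i j with hij | hij
  · have := hp.dist_eq hT hij hj
    rw [h, dist_self] at this
    omega
  · have := hp.dist_eq hT hij hi
    rw [h, dist_self] at this
    omega

/-- Going along a path of a tree, once the distance to `v` increases it keeps increasing. -/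
theorem dist_add_of_dist_succ (hT : T.IsTree) (h : ∀ i < D, T.Adj (p i) (p (i + 1)))
    (hne : ∀ i, i + 2 ≤ D → p i ≠ p (i + 2)) {v : V} {i : ℕ}
    (hi : T.dist v (p (i + 1)) = T.dist v (p i) + 1) {j : ℕ} (hj : i + 1 + j ≤ D) :
    T.dist v (p (i + 1 + j)) = T.dist v (p i) + (j + 1) := by
  suffices T.dist v (p (i + j)) = T.dist v (p i) + j ∧
      T.dist v (p (i + 1 + j)) = T.dist v (p i) + (j + 1) from this.2
  induction j with
  | zero => simpa using hi
  | succ j ih =>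
    obtain ⟨ih₁, ih₂⟩ := ih (by omega)
    refine ⟨by rw [← ih₂]; congr 2; omega, ?_⟩
    rcases hT.dist_eq_add_one_or (h (i + j) (by omega)).symm (h (i + j + 1) (by omega))
      (hne (i + j) (by omega)) v with h' | h'
    · rw [show i + j + 1 = i + 1 + j by omega] at h'
      omega
    · rw [show i + j + 1 + 1 = i + 1 + (j + 1) by omega, show i + j + 1 = i + 1 + j by omega] at h'
      omega

theorem IsGeodesic.of_adj (hT : T.IsTree) (h : ∀ i < D, T.Adj (p i) (p (i + 1)))
    (hne : ∀ i, i + 2 ≤ D → p i ≠ p (i + 2)) : IsGeodesic T D p := by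
  refine ⟨h, ?_⟩
  rcases D with _ | D
  · simp
  · have := dist_add_of_dist_succ hT h hne (v := p 0) (i := 0)
      (by simpa using dist_eq_one_iff_adj.2 (h 0 (by omega))) (j := D) (by omega)
    rw [dist_self, zero_add, zero_add, add_comm 1 D] at this
    exact this

theorem IsGeodesic.ne_add_two (hT : T.Connected) (hp : IsGeodesic T D p) (i : ℕ)
    (hi : i + 2 ≤ D) : p i ≠ p (i + 2) := fun h => by
  have := hp.injOn hT (show i ∈ Set.Iic D by simp; omega) (show i + 2 ∈ Set.Iic D by simpa) h
  omega

/-- The reversed path. -/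
theorem IsGeodesic.reverse (hp : IsGeodesic T D p) : IsGeodesic T D (fun i => p (D - i)) := by
  refine ⟨fun i hi => ?_, by simpa [dist_comm] using hp.dist_ends⟩
  have := (hp.adj (D - (i + 1)) (by omega)).symm
  rwa [show D - (i + 1) + 1 = D - i by omega] at this

theorem IsDiametral.reverse (hp : IsDiametral T D p) : IsDiametral T D (fun i => p (D - i)) :=
  ⟨hp.toIsGeodesic.reverse, hp.dist_le⟩

/-- A neighbour `q` of `p i` away from `p (i + 1)` has distance `1 + (D - i)` to `p D`. -/
theorem IsGeodesic.dist_end_of_adj (hT : T.IsTree) (hp : IsGeodesic T D p) {i : ℕ} (hi : i ≤ D)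
    {q : V} (hq : T.Adj (p i) q) (hne : i < D → q ≠ p (i + 1)) :
    T.dist q (p D) = D - i + 1 := by
  have hq₁ : T.dist q (p i) = 1 := dist_eq_one_iff_adj.2 hq.symm
  rcases hi.eq_or_lt with rfl | hi
  · simp [hq₁]
  · have h : T.dist q (p (i + 1)) = T.dist q (p i) + 1 := by
      rcases hT.dist_eq_add_one_or hq (hp.adj i hi) (hne hi) q with h | h
      · simp at h
      · exact h
    have := dist_add_of_dist_succ hT hp.adj (hp.ne_add_two hT.connected) h (j := D - (i + 1))
      (by omega)
    rw [show i + 1 + (D - (i + 1)) = D by omega] at this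
    omega

theorem IsGeodesic.dist_start_of_adj (hT : T.IsTree) (hp : IsGeodesic T D p) {i : ℕ} (hi : i ≤ D)
    {q : V} (hq : T.Adj (p i) q) (hne : 0 < i → q ≠ p (i - 1)) :
    T.dist q (p 0) = i + 1 := by
  have := hp.reverse.dist_end_of_adj hT (i := D - i) (q := q) (by omega)
    (by simpa [Nat.sub_sub_self hi] using hq)
    (fun h => by
      rw [show D - (D - i + 1) = i - 1 by omega]
      exact hne (by omega))
  rw [Nat.sub_sub_self hi] at this
  simpa using this

theorem IsDiametral.dist_path_le (hT : T.IsTree) (hp : IsDiametral T D p) {i : ℕ} (hi : i ≤ D)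
    (v : V) : T.dist (p i) v ≤ max i (D - i) := by
  have forward : ∀ {p : ℕ → V} {i : ℕ}, IsDiametral T D p → i < D →
      T.dist v (p (i + 1)) = T.dist v (p i) + 1 → T.dist v (p i) ≤ i := by
    intro p i hp hi h
    have h₁ := dist_add_of_dist_succ hT hp.adj (hp.ne_add_two hT.connected) h (j := D - (i + 1))
      (by omega)
    rw [show i + 1 + (D - (i + 1)) = D by omega] at h₁
    have := hp.dist_le v (p D)
    omega
  rw [dist_comm]
  rcases Nat.eq_zero_or_pos i with rfl | h0
  · have := hp.dist_le v (p 0)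
    omega
  rcases hi.eq_or_lt with rfl | hi
  · have := hp.dist_le v (p i)
    omega
  have hprev := (hp.adj (i - 1) (by omega)).symm
  have hne := hp.ne_add_two hT.connected (i - 1) (by omega)
  rw [show i - 1 + 1 = i by omega] at hprev
  rw [show i - 1 + 2 = i + 1 by omega] at hne
  rcases hT.dist_eq_add_one_or hprev (hp.adj i hi) hne v with h | h
  · have := forward (i := D - i) hp.reverse (by omega)
      (by rw [Nat.sub_sub_self hi.le, show D - (D - i + 1) = i - 1 by omega]; exact h)
    rw [Nat.sub_sub_self hi.le] at this
    omega
  · have := forward hp hi h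
    omega

theorem exists_isDiametral [Fintype V] (hT : T.IsTree) : ∃ D p, IsDiametral T D p := by
  have := hT.connected.nonempty
  obtain ⟨⟨u, v⟩, huv⟩ := Finite.exists_max (fun x : V × V => T.dist x.1 x.2)
  obtain ⟨w, hw⟩ := hT.connected.exists_walk_length_eq_dist u v
  refine ⟨T.dist u v, w.getVert, ⟨fun i hi => w.adj_getVert_succ (hw ▸ hi), ?_⟩,
    fun x y => huv (x, y)⟩
  rw [← hw, Walk.getVert_length, Walk.getVert_zero, hw]

/-- Neighbours of distinct path vertices outside of the path are distinct. -/
theorem IsGeodesic.eq_of_adj_of_adj (hT : T.IsTree) (hp : IsGeodesic T D p) {i j : ℕ}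
    (hi : i ≤ D) (hj : j ≤ D) {q : V} (hq : ∀ k ≤ D, q ≠ p k) (hqi : T.Adj (p i) q)
    (hqj : T.Adj (p j) q) : i = j := by
  have h₁ := hp.dist_end_of_adj hT hi hqi (fun h => hq _ h)
  have h₂ := hp.dist_end_of_adj hT hj hqj (fun h => hq _ h)
  omega

end Geodesic

/-! ### Degrees and eccentricities -/

section Degree

variable [Fintype V] {T : SimpleGraph V}

theorem two_le_deg_iff {v : V} : 2 ≤ deg T v ↔ ∃ a b, T.Adj v a ∧ T.Adj v b ∧ a ≠ b := by
  classical
  unfold deg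
  rw [show (2 : ℕ) = 1 + 1 from rfl, Nat.add_one_le_iff, Finset.one_lt_card_iff]
  simp only [Finset.mem_filter, Finset.mem_univ, true_and]

theorem exists_adj_ne_of_two_le_deg {v : V} (h : 2 ≤ deg T v) (x : V) :
    ∃ q, T.Adj v q ∧ q ≠ x := by
  obtain ⟨a, b, ha, hb, hab⟩ := two_le_deg_iff.1 h
  by_cases hx : a = x
  · exact ⟨b, hb, fun h => hab (hx.trans h.symm)⟩
  · exact ⟨a, ha, hx⟩

theorem exists_adj_ne_ne_of_three_le_deg {v : V} (h : 3 ≤ deg T v) (x y : V) :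
    ∃ q, T.Adj v q ∧ q ≠ x ∧ q ≠ y := by
  classical
  have hlt : ({x, y} : Finset V).card < deg T v := lt_of_le_of_lt Finset.card_le_two h
  obtain ⟨q, hq, hne⟩ := Finset.exists_mem_notMem_of_card_lt_card hlt
  simp only [Finset.mem_filter, Finset.mem_univ, true_and, Finset.mem_insert,
    Finset.mem_singleton, not_or] at hq hne
  exact ⟨q, hq, hne⟩

theorem sum_deg_add_two (hT : T.IsTree) : ∑ v, deg T v + 2 = 2 * Fintype.card V := by
  classical
  have h₁ := T.sum_degrees_eq_twice_card_edges
  have h₂ := hT.card_edgeFinset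
  have h₃ : ∀ v, deg T v = T.degree v := fun v => by
    unfold deg
    rw [← card_neighborFinset_eq_degree, neighborFinset_eq_filter]
  simp only [h₃, h₁]
  omega

theorem exists_adj_of_connected (hT : T.Connected) (hV : 2 ≤ Fintype.card V) (v : V) :
    ∃ w, T.Adj v w := by
  have : Nontrivial V := Fintype.one_lt_card_iff_nontrivial.1 hV
  exact hT.preconnected.exists_adj_of_nontrivial v

theorem one_le_deg_of_adj {v w : V} (h : T.Adj v w) : 1 ≤ deg T v :=
  Finset.card_pos.2 ⟨w, by simpa using h⟩

theorem one_le_deg (hT : T.Connected) (hV : 2 ≤ Fintype.card V) (v : V) : 1 ≤ deg T v :=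
  (exists_adj_of_connected hT hV v).elim fun _ => one_le_deg_of_adj

theorem dist_le_ecc_s11 (u v : V) : T.dist u v ≤ ecc T u :=
  Finset.le_sup (f := fun v => T.dist u v) (Finset.mem_univ v)

theorem ecc_le_iff {u : V} {e : ℕ} : ecc T u ≤ e ↔ ∀ v, T.dist u v ≤ e := by
  simp [ecc]

theorem one_le_ecc (hT : T.Connected) (hV : 2 ≤ Fintype.card V) (v : V) : 1 ≤ ecc T v := by
  obtain ⟨w, hw⟩ := exists_adj_of_connected hT hV v
  exact (dist_eq_one_iff_adj.2 hw).symm.le.trans (dist_le_ecc_s11 v w)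

theorem ecc_le_ecc_add_one (hT : T.Connected) {u v : V} (h : T.Adj u v) :
    ecc T v ≤ ecc T u + 1 := by
  refine ecc_le_iff.2 fun x => ?_
  have h₁ := hT.dist_triangle (u := v) (v := u) (w := x)
  have h₂ := dist_eq_one_iff_adj.2 h.symm
  have h₃ := dist_le_ecc_s11 (T := T) u x
  omega

variable {D : ℕ} {p : ℕ → V}

theorem IsDiametral.ecc_le (hp : IsDiametral T D p) (v : V) : ecc T v ≤ D :=
  ecc_le_iff.2 (hp.dist_le v)

theorem IsDiametral.ecc_lt (hT : T.IsTree) (hp : IsDiametral T D p) {v : V}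
    (hv : 2 ≤ deg T v) : ecc T v + 1 ≤ D := by
  obtain ⟨a, b, ha, hb, hab⟩ := two_le_deg_iff.1 hv
  have h : ∀ x, T.dist v x + 1 ≤ D := fun x => by
    have h₁ := hp.dist_le x a
    have h₂ := hp.dist_le x b
    rw [dist_comm]
    rcases hT.dist_eq_add_one_or ha hb hab x with h | h <;> omega
  have h₀ := h v
  have := ecc_le_iff (T := T) (u := v) (e := D - 1) |>.2 fun x => by
    have := h x
    omega
  omega

theorem IsGeodesic.two_le_deg (hT : T.Connected) (hp : IsGeodesic T D p) {i : ℕ} (h0 : 0 < i)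
    (hi : i < D) : 2 ≤ deg T (p i) := by
  have h₁ := (hp.adj (i - 1) (by omega)).symm
  have h₂ := hp.ne_add_two hT (i - 1) (by omega)
  rw [show i - 1 + 1 = i by omega] at h₁
  rw [show i - 1 + 2 = i + 1 by omega] at h₂
  exact two_le_deg_iff.2 ⟨_, _, h₁, hp.adj i hi, h₂⟩

theorem IsDiametral.deg_start (hT : T.IsTree) (hV : 2 ≤ Fintype.card V)
    (hp : IsDiametral T D p) : deg T (p 0) = 1 := by
  have h₁ := one_le_deg hT.connected hV (p 0)
  by_contra h
  have h₂ := hp.ecc_lt hT (v := p 0) (by omega)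
  have h₃ := dist_le_ecc_s11 (T := T) (p 0) (p D)
  rw [hp.dist_ends] at h₃
  omega

theorem IsDiametral.deg_end (hT : T.IsTree) (hV : 2 ≤ Fintype.card V)
    (hp : IsDiametral T D p) : deg T (p D) = 1 := by
  simpa using hp.reverse.deg_start hT hV

theorem IsDiametral.one_le (hV : 2 ≤ Fintype.card V) (hT : T.IsTree)
    (hp : IsDiametral T D p) : 1 ≤ D :=
  (one_le_ecc hT.connected hV (p 0)).trans (hp.ecc_le _)

end Degree

/-! ### The branching vertices on and off a diametral path -/

/-- The eccentricity of the `i`-th vertex of a path of length `D`. -/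
def level (D i : ℕ) : ℕ := max i (D - i)

/-- The degree of the `i`-th vertex of a path of length `D`. -/
def pathDeg (D i : ℕ) : ℕ := if i = 0 ∨ i = D then 1 else 2

theorem sum_pathDeg {D : ℕ} (hD : 1 ≤ D) : ∑ i ∈ range (D + 1), pathDeg D i = 2 * D := by
  obtain ⟨D, rfl⟩ := Nat.exists_eq_add_of_le' hD
  rw [Finset.sum_range_succ, Finset.sum_range_succ']
  have : ∀ i ∈ range D, pathDeg (D + 1) (i + 1) = 2 := fun i hi => by
    have := Finset.mem_range.1 hi
    rw [pathDeg, if_neg (by omega)]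
  rw [Finset.sum_congr rfl this]
  simp [pathDeg]
  omega

section Path

variable [Fintype V] (T : SimpleGraph V) (D : ℕ) (p : ℕ → V)

/-- The indices of the branching vertices of `p 0, …, p D`. -/
noncomputable def branchIndices : Finset ℕ := {i ∈ range (D + 1) | 3 ≤ deg T (p i)}

open Classical in
/-- The vertices not among `p 0, …, p D`. -/
noncomputable def offPath : Finset V := {v | ∀ k ≤ D, v ≠ p k}

variable {T D p}

theorem mem_branchIndices {i : ℕ} : i ∈ branchIndices T D p ↔ i ≤ D ∧ 3 ≤ deg T (p i) := by
  simp [branchIndices]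

theorem filter_mem_branchIndices :
    (range (D + 1)).filter (· ∈ branchIndices T D p) = branchIndices T D p := by
  ext i
  simp only [branchIndices, Finset.mem_filter]
  tauto

theorem mem_offPath {v : V} : v ∈ offPath D p ↔ ∀ k ≤ D, v ≠ p k := by
  simp [offPath]

theorem sum_eq_sum_path_add_sum_offPath {M : Type*} [AddCommMonoid M] (hT : T.Connected)
    (hp : IsGeodesic T D p) (g : V → M) :
    ∑ v, g v = ∑ i ∈ range (D + 1), g (p i) + ∑ v ∈ offPath D p, g v := by
  classical
  have hinj : Set.InjOn p (range (D + 1)) := fun i hi j hj h =>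
    hp.injOn hT (by simpa [Nat.lt_succ_iff] using hi) (by simpa [Nat.lt_succ_iff] using hj) h
  have hoff : offPath D p = ((range (D + 1)).image p)ᶜ := by
    ext v
    simp only [mem_offPath, Finset.mem_compl, Finset.mem_image, Finset.mem_range, not_exists,
      not_and, Nat.lt_succ_iff]
    exact ⟨fun h k hk e => h k hk e.symm, fun h k hk e => h k hk e.symm⟩
  rw [hoff, ← Finset.sum_image hinj, Finset.sum_add_sum_compl]

theorem card_eq_add_card_offPath (hT : T.Connected) (hp : IsGeodesic T D p) :
    Fintype.card V = D + 1 + (offPath D p).card := by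
  have := sum_eq_sum_path_add_sum_offPath hT hp (fun _ => 1)
  simpa using this

theorem IsDiametral.deg_path (hT : T.IsTree) (hV : 2 ≤ Fintype.card V) (hp : IsDiametral T D p)
    {i : ℕ} (hi : i ≤ D) :
    deg T (p i) = pathDeg D i + if i ∈ branchIndices T D p then 1 + (deg T (p i) - 3) else 0 := by
  have hB : i ∈ branchIndices T D p ↔ 3 ≤ deg T (p i) := by simp [mem_branchIndices, hi]
  simp only [hB, pathDeg]
  by_cases h : i = 0 ∨ i = D
  · have h₁ : deg T (p i) = 1 := by
      rcases h with rfl | rfl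
      exacts [hp.deg_start hT hV, hp.deg_end hT hV]
    simp [h, h₁]
  · have := hp.two_le_deg hT.connected (i := i) (by omega) (by omega)
    simp only [h, if_false]
    split_ifs <;> omega

theorem IsDiametral.pos_lt_of_mem_branchIndices (hT : T.IsTree) (hV : 2 ≤ Fintype.card V)
    (hp : IsDiametral T D p) {i : ℕ} (h : i ∈ branchIndices T D p) : 0 < i ∧ i < D := by
  obtain ⟨hi, hd⟩ := mem_branchIndices.1 h
  refine ⟨Nat.pos_of_ne_zero ?_, hi.lt_of_ne ?_⟩
  · rintro rfl
    rw [hp.deg_start hT hV] at hd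
    omega
  · rintro rfl
    rw [hp.deg_end hT hV] at hd
    omega

/-- The degree sum formula, relative to a diametral path. -/
theorem IsDiametral.card_offPath (hT : T.IsTree) (hV : 2 ≤ Fintype.card V)
    (hp : IsDiametral T D p) :
    (offPath D p).card = (branchIndices T D p).card +
      (∑ i ∈ branchIndices T D p, (deg T (p i) - 3) + ∑ v ∈ offPath D p, (deg T v - 1)) := by
  have h₁ := sum_deg_add_two hT
  rw [sum_eq_sum_path_add_sum_offPath hT.connected hp.toIsGeodesic,
    card_eq_add_card_offPath hT.connected hp.toIsGeodesic,
    Finset.sum_congr rfl fun i hi => hp.deg_path hT hV (Nat.lt_succ_iff.1 (Finset.mem_range.1 hi)),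
    Finset.sum_add_distrib, sum_pathDeg (hp.one_le hV hT), ← Finset.sum_filter,
    filter_mem_branchIndices,
    Finset.sum_add_distrib, Finset.sum_congr rfl (s₁ := offPath D p) (g := fun v =>
      (deg T v - 1) + 1) fun v _ => (Nat.sub_add_cancel (one_le_deg hT.connected hV v)).symm,
    Finset.sum_add_distrib] at h₁
  simp only [Finset.sum_const, smul_eq_mul, mul_one] at h₁
  omega

theorem branchCount_eq (hT : T.Connected) (hp : IsGeodesic T D p) :
    branchCount T =
      (branchIndices T D p).card + ((offPath D p).filter (fun v => 3 ≤ deg T v)).card := by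
  have := sum_eq_sum_path_add_sum_offPath hT hp (fun v => if 3 ≤ deg T v then 1 else 0)
  simpa only [branchCount, branchIndices, Finset.card_filter] using this

/-- The number of vertices off a diametral path is at least the number of branching vertices,
plus the number of those branching vertices that lie off the path. -/
theorem IsDiametral.branchCount_add_le (hT : T.IsTree) (hV : 2 ≤ Fintype.card V)
    (hp : IsDiametral T D p) :
    branchCount T + ((offPath D p).filter (fun v => 3 ≤ deg T v)).card ≤ (offPath D p).card := by
  have h₁ := hp.card_offPath hT hV
  have h₂ := branchCount_eq hT.connected hp.toIsGeodesic
  have h₃ : 2 * ((offPath D p).filter (fun v => 3 ≤ deg T v)).card ≤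
      ∑ v ∈ offPath D p, (deg T v - 1) := by
    rw [mul_comm, ← smul_eq_mul]
    refine (Finset.card_nsmul_le_sum _ _ 2 fun v hv => ?_).trans
      (Finset.sum_le_sum_of_subset (Finset.filter_subset _ _))
    have := (Finset.mem_filter.1 hv).2
    omega
  omega

/-- Every branching vertex of a diametral path has a neighbour off the path. -/
theorem IsDiametral.exists_pendant (hT : T.IsTree) (hV : 2 ≤ Fintype.card V)
    (hp : IsDiametral T D p) : ∃ q : ℕ → V, (∀ i ∈ branchIndices T D p,
      T.Adj (p i) (q i) ∧ q i ∈ offPath D p) ∧ Set.InjOn q (branchIndices T D p) := by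
  have h : ∀ i, ∃ q, i ∈ branchIndices T D p → T.Adj (p i) q ∧ q ∈ offPath D p := by
    intro i
    by_cases hi : i ∈ branchIndices T D p
    · obtain ⟨h0, hD⟩ := hp.pos_lt_of_mem_branchIndices hT hV hi
      obtain ⟨q, hq, h₁, h₂⟩ := exists_adj_ne_ne_of_three_le_deg (mem_branchIndices.1 hi).2
        (p (i - 1)) (p (i + 1))
      refine ⟨q, fun _ => ⟨hq, mem_offPath.2 ?_⟩⟩
      rintro k hk rfl
      have hd := dist_eq_one_iff_adj.2 hq
      rcases le_total i k with hik | hik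
      · rw [hp.dist_eq hT.connected hik hk] at hd
        exact h₂ (by rw [show k = i + 1 by omega])
      · rw [dist_comm, hp.dist_eq hT.connected hik hD.le] at hd
        exact h₁ (by rw [show k = i - 1 by omega])
    · exact ⟨p 0, fun h => absurd h hi⟩
  choose q hq using h
  refine ⟨q, hq, fun i hi j hj hij => ?_⟩
  have hi' := hq i hi
  have hj' := hq j hj
  rw [← hij] at hj'
  exact hp.eq_of_adj_of_adj hT (mem_branchIndices.1 hi).1 (mem_branchIndices.1 hj).1
    (mem_offPath.1 hi'.2) hi'.1 hj'.1

end Path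

/-! ### Bounds on the connective eccentricity index -/

/-- The contribution of an edge whose ends have eccentricities `e` and `e + 1`. -/
noncomputable def edgeWeight (e : ℕ) : ℝ := 1 / (e : ℝ) + 1 / ((e : ℝ) + 1)

/-- The connective eccentricity index of a path of length `D`. -/
noncomputable def pathCei (D : ℕ) : ℝ := ∑ i ∈ range (D + 1), (pathDeg D i : ℝ) / (level D i : ℝ)

theorem edgeWeight_lt {a b : ℕ} (ha : 1 ≤ a) (hab : a < b) : edgeWeight b < edgeWeight a := by
  have ha' : (0 : ℝ) < a := by exact_mod_cast ha
  have hab' : (a : ℝ) < b := by exact_mod_cast hab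
  unfold edgeWeight
  gcongr

theorem edgeWeight_le {a b : ℕ} (ha : 1 ≤ a) (hab : a ≤ b) : edgeWeight b ≤ edgeWeight a := by
  rcases hab.eq_or_lt with rfl | h
  · exact le_rfl
  · exact (edgeWeight_lt ha h).le

theorem edgeWeight_inj {a b : ℕ} (ha : 1 ≤ a) (hb : 1 ≤ b) (h : edgeWeight a = edgeWeight b) :
    a = b := by
  rcases lt_trichotomy a b with hab | hab | hab
  · exact absurd h (edgeWeight_lt ha hab).ne'
  · exact hab
  · exact absurd h (edgeWeight_lt hb hab).ne

theorem pathCei_eq_sum_edges {D : ℕ} (hD : 1 ≤ D) :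
    pathCei D = ∑ i ∈ range D, (1 / (level D i : ℝ) + 1 / (level D (i + 1) : ℝ)) := by
  obtain ⟨D, rfl⟩ := Nat.exists_eq_add_of_le' hD
  have h : ∀ i ∈ range D, (pathDeg (D + 1) (i + 1) : ℝ) / (level (D + 1) (i + 1) : ℝ) =
      1 / (level (D + 1) (i + 1) : ℝ) + 1 / (level (D + 1) (i + 1) : ℝ) := fun i hi => by
    have := Finset.mem_range.1 hi
    rw [pathDeg, if_neg (by omega)]
    push_cast
    ring
  rw [pathCei, Finset.sum_range_succ, Finset.sum_range_succ', Finset.sum_congr rfl h,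
    Finset.sum_add_distrib, Finset.sum_add_distrib, Finset.sum_range_succ',
    Finset.sum_range_succ (fun i => 1 / (level (D + 1) (i + 1) : ℝ))]
  simp only [pathDeg, true_or, or_true, if_true, Nat.cast_one]
  ring

/-- Lengthening a path by `t` edges increases its index by at most `t` edge weights. -/
theorem pathCei_add_le {D : ℕ} (hD : 1 ≤ D) (t : ℕ) :
    pathCei (D + t) ≤ pathCei D + t * edgeWeight D := by
  have hD' : (0 : ℝ) < D := by exact_mod_cast hD
  have mono : ∀ {a b : ℕ}, 1 ≤ a → a ≤ b → 1 / (b : ℝ) ≤ 1 / (a : ℝ) := fun {a b} ha hab => by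
    have : (0 : ℝ) < a := by exact_mod_cast ha
    have : (a : ℝ) ≤ b := by exact_mod_cast hab
    gcongr
  rw [pathCei_eq_sum_edges hD, pathCei_eq_sum_edges (show 1 ≤ D + t by omega), add_comm D t,
    Finset.sum_range_add, add_comm]
  refine add_le_add (Finset.sum_le_sum fun i hi => ?_) ?_
  · have := Finset.mem_range.1 hi
    refine add_le_add (mono ?_ ?_) (mono ?_ ?_) <;> simp only [level] <;> omega
  · rw [← nsmul_eq_mul]
    refine (Finset.sum_le_card_nsmul _ _ (edgeWeight D) fun i hi => ?_).trans_eq (by simp)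
    have := Finset.mem_range.1 hi
    rw [edgeWeight, add_comm]
    refine add_le_add (mono hD ?_) ?_
    · simp only [level]; omega
    · exact_mod_cast mono (show 1 ≤ D + 1 by omega)
        (show D + 1 ≤ level (t + D) i by simp only [level]; omega)

theorem div_add_div_le_div {d ε e D : ℕ} (hd : 1 ≤ d) (hε : 1 ≤ ε) (he : ε ≤ e)
    (hD : 2 ≤ d → ε ≤ D) : 1 / (e : ℝ) + ((d - 1 : ℕ) : ℝ) / (D : ℝ) ≤ (d : ℝ) / (ε : ℝ) := by
  have hε' : (0 : ℝ) < ε := by exact_mod_cast hε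
  have he' : (ε : ℝ) ≤ e := by exact_mod_cast he
  have hsplit : (d : ℝ) / (ε : ℝ) = 1 / (ε : ℝ) + ((d - 1 : ℕ) : ℝ) / (ε : ℝ) := by
    rw [Nat.cast_sub hd]
    push_cast
    ring
  rw [hsplit]
  refine add_le_add (by gcongr) ?_
  rcases hd.eq_or_lt with rfl | hd
  · simp
  · have : (ε : ℝ) ≤ D := by exact_mod_cast hD hd
    gcongr

section Bounds

variable [Fintype V] {T : SimpleGraph V} {D : ℕ} {p : ℕ → V}

theorem IsDiametral.le_deg_div_ecc_path (hT : T.IsTree) (hV : 2 ≤ Fintype.card V)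
    (hp : IsDiametral T D p) {i : ℕ} (hi : i ≤ D) :
    (pathDeg D i : ℝ) / (level D i : ℝ) + (if i ∈ branchIndices T D p then
      1 / (level D i : ℝ) + ((deg T (p i) - 3 : ℕ) : ℝ) / ((D - 1 : ℕ) : ℝ) else 0) ≤
      (deg T (p i) : ℝ) / (ecc T (p i) : ℝ) := by
  have hε : (0 : ℝ) < ecc T (p i) := by exact_mod_cast one_le_ecc hT.connected hV (p i)
  have he : (ecc T (p i) : ℝ) ≤ level D i := by
    exact_mod_cast ecc_le_iff.2 (hp.dist_path_le hT hi)
  have hl : (0 : ℝ) < level D i := hε.trans_le he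
  have hle : (deg T (p i) : ℝ) / (level D i : ℝ) ≤ (deg T (p i) : ℝ) / (ecc T (p i) : ℝ) := by
    gcongr
  refine le_trans ?_ hle
  have hd := hp.deg_path hT hV hi
  split_ifs at hd ⊢ with hB
  · obtain ⟨h0, hD⟩ := hp.pos_lt_of_mem_branchIndices hT hV hB
    have hlD : (level D i : ℝ) ≤ ((D - 1 : ℕ) : ℝ) := by
      exact_mod_cast (show level D i ≤ D - 1 by simp only [level]; omega)
    have hd' : (deg T (p i) : ℝ) = pathDeg D i + (1 + ((deg T (p i) - 3 : ℕ) : ℝ)) := by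
      exact_mod_cast hd
    rw [hd', add_div, add_div]
    gcongr
  · rw [add_zero] at hd
    rw [add_zero, hd]

theorem IsDiametral.le_deg_div_ecc (hT : T.IsTree) (hV : 2 ≤ Fintype.card V)
    (hp : IsDiametral T D p) {v : V} {e : ℕ} (he : ecc T v ≤ e) :
    1 / (e : ℝ) + ((deg T v - 1 : ℕ) : ℝ) / ((D - 1 : ℕ) : ℝ) ≤
      (deg T v : ℝ) / (ecc T v : ℝ) :=
  div_add_div_le_div (one_le_deg hT.connected hV v) (one_le_ecc hT.connected hV v) he
    fun h => by
      have := hp.ecc_lt hT h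
      omega

/-- Lower bound for the index in terms of the branching vertices of a diametral path and the
number of vertices off that path. -/
theorem IsDiametral.le_cei (hT : T.IsTree) (hV : 2 ≤ Fintype.card V) (hp : IsDiametral T D p) :
    pathCei D + ∑ i ∈ branchIndices T D p, edgeWeight (level D i) +
      ((offPath D p).card - (branchIndices T D p).card : ℝ) * edgeWeight (D - 1) ≤ cei T := by
  classical
  set B := branchIndices T D p
  obtain ⟨q, hq, hqinj⟩ := hp.exists_pendant hT hV
  have hD := hp.one_le hV hT
  have hpath : pathCei D + ∑ i ∈ B, (1 / (level D i : ℝ) +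
      ((deg T (p i) - 3 : ℕ) : ℝ) / ((D - 1 : ℕ) : ℝ)) ≤
      ∑ i ∈ range (D + 1), (deg T (p i) : ℝ) / (ecc T (p i) : ℝ) := by
    have hBf : B = (range (D + 1)).filter (· ∈ B) := filter_mem_branchIndices.symm
    conv_lhs => rw [hBf]
    rw [pathCei, Finset.sum_filter, ← Finset.sum_add_distrib]
    exact Finset.sum_le_sum fun i hi =>
      hp.le_deg_div_ecc_path hT hV (Nat.lt_succ_iff.1 (Finset.mem_range.1 hi))
  let g : V → ℝ := fun v =>
    (deg T v : ℝ) / (ecc T v : ℝ) - ((deg T v - 1 : ℕ) : ℝ) / ((D - 1 : ℕ) : ℝ)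
  have hg : ∀ {v : V} {e : ℕ}, ecc T v ≤ e → 1 / (e : ℝ) ≤ g v := fun he =>
    le_sub_iff_add_le.2 (hp.le_deg_div_ecc hT hV he)
  have hsub : B.image q ⊆ offPath D p := Finset.image_subset_iff.2 fun i hi => (hq i hi).2
  have hoff : ∑ i ∈ B, 1 / ((level D i : ℝ) + 1) +
      ((offPath D p).card - B.card : ℝ) * (1 / (D : ℝ)) ≤ ∑ v ∈ offPath D p, g v := by
    rw [← Finset.sum_sdiff hsub, Finset.sum_image hqinj, add_comm]
    refine add_le_add ?_ (Finset.sum_le_sum fun i hi => ?_)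
    · have hc : ((offPath D p \ B.image q).card : ℝ) = (offPath D p).card - B.card := by
        rw [Finset.cast_card_sdiff hsub, Finset.card_image_of_injOn hqinj]
      rw [← hc, ← nsmul_eq_mul]
      exact Finset.card_nsmul_le_sum _ _ _ fun v _ => hg (hp.ecc_le v)
    · have := hg (v := q i) (e := level D i + 1)
        ((ecc_le_ecc_add_one hT.connected (hq i hi).1).trans (Nat.add_le_add_right
          (ecc_le_iff.2 (hp.dist_path_le hT (mem_branchIndices.1 hi).1)) 1))
      exact_mod_cast this
  have hcard : ((offPath D p).card - B.card : ℝ) =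
      ∑ i ∈ B, ((deg T (p i) - 3 : ℕ) : ℝ) + ∑ v ∈ offPath D p, ((deg T v - 1 : ℕ) : ℝ) := by
    rw [hp.card_offPath hT hV]
    push_cast
    ring
  have hweight : edgeWeight (D - 1) = 1 / ((D - 1 : ℕ) : ℝ) + 1 / (D : ℝ) := by
    rw [edgeWeight]
    congr 2
    exact_mod_cast Nat.sub_add_cancel hD
  rw [cei, sum_eq_sum_path_add_sum_offPath hT.connected hp.toIsGeodesic, hweight]
  simp only [g, Finset.sum_sub_distrib, Finset.sum_add_distrib, ← Finset.sum_div] at hoff hpath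
  simp only [edgeWeight, Finset.sum_add_distrib]
  have : ((offPath D p).card - B.card : ℝ) * (1 / ((D - 1 : ℕ) : ℝ)) =
      (∑ i ∈ B, ((deg T (p i) - 3 : ℕ) : ℝ)) / ((D - 1 : ℕ) : ℝ) +
      (∑ v ∈ offPath D p, ((deg T v - 1 : ℕ) : ℝ)) / ((D - 1 : ℕ) : ℝ) := by
    rw [hcard]
    ring
  rw [mul_add, this]
  linarith

theorem level_le_ecc (hT : T.Connected) (hp : IsGeodesic T D p) {i : ℕ} (hi : i ≤ D) :
    level D i ≤ ecc T (p i) := by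
  have h₁ := dist_le_ecc_s11 (T := T) (p i) (p 0)
  have h₂ := dist_le_ecc_s11 (T := T) (p i) (p D)
  rw [dist_comm, hp.dist_eq hT (Nat.zero_le i) hi] at h₁
  rw [hp.dist_eq hT hi le_rfl] at h₂
  simp only [level]
  omega

theorem level_add_one_le_ecc (hT : T.IsTree) (hp : IsGeodesic T D p) {i : ℕ} (hi : i ≤ D)
    {q : V} (hq : T.Adj (p i) q) (hoff : q ∈ offPath D p) : level D i + 1 ≤ ecc T q := by
  have hoff := mem_offPath.1 hoff
  have h₁ := dist_le_ecc_s11 (T := T) q (p 0)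
  have h₂ := dist_le_ecc_s11 (T := T) q (p D)
  rw [hp.dist_start_of_adj hT hi hq fun _ => hoff _ (by omega)] at h₁
  rw [hp.dist_end_of_adj hT hi hq fun h => hoff _ h] at h₂
  simp only [level]
  omega

/-- Upper bound for the index of a tree having as few vertices off a diametral path as
possible. -/
theorem IsDiametral.cei_le (hT : T.IsTree) (hV : 2 ≤ Fintype.card V) (hp : IsDiametral T D p)
    (hcard : (offPath D p).card = (branchIndices T D p).card) :
    cei T ≤ pathCei D + ∑ i ∈ branchIndices T D p, edgeWeight (level D i) := by
  classical
  set B := branchIndices T D p with hB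
  obtain ⟨q, hq, hqinj⟩ := hp.exists_pendant hT hV
  have hD := hp.one_le hV hT
  have hsub : B.image q ⊆ offPath D p := Finset.image_subset_iff.2 fun i hi => (hq i hi).2
  have heq : offPath D p = B.image q := (Finset.eq_of_subset_of_card_le hsub
    (by rw [Finset.card_image_of_injOn hqinj, hcard])).symm
  have hzero := hp.card_offPath hT hV
  rw [← hB] at hzero
  have hdegB : ∀ i ∈ B, deg T (p i) - 3 = 0 := fun i hi =>
    Finset.sum_eq_zero_iff.1 (show ∑ i ∈ B, (deg T (p i) - 3) = 0 by omega) i hi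
  have hdegoff : ∀ v ∈ offPath D p, deg T v - 1 = 0 := fun v hv =>
    Finset.sum_eq_zero_iff.1 (show ∑ v ∈ offPath D p, (deg T v - 1) = 0 by omega) v hv
  have hpath : ∑ i ∈ range (D + 1), (deg T (p i) : ℝ) / (ecc T (p i) : ℝ) ≤
      pathCei D + ∑ i ∈ B, 1 / (level D i : ℝ) := by
    have hBf : B = (range (D + 1)).filter (· ∈ B) := filter_mem_branchIndices.symm
    conv_rhs => rw [hBf]
    rw [pathCei, Finset.sum_filter, ← Finset.sum_add_distrib]
    refine Finset.sum_le_sum fun i hi => ?_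
    have hi := Nat.lt_succ_iff.1 (Finset.mem_range.1 hi)
    have hl : (0 : ℝ) < level D i := by
      exact_mod_cast (show 0 < level D i by simp only [level]; omega)
    have hle : (level D i : ℝ) ≤ ecc T (p i) := by
      exact_mod_cast level_le_ecc hT.connected hp.toIsGeodesic hi
    have : (deg T (p i) : ℝ) / (ecc T (p i) : ℝ) ≤ (deg T (p i) : ℝ) / (level D i : ℝ) := by
      gcongr
    refine this.trans_eq ?_
    have hd := hp.deg_path hT hV hi
    split_ifs at hd ⊢ with hiB
    · rw [hdegB i hiB, add_zero] at hd
      rw [hd]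
      push_cast
      ring
    · rw [hd, add_zero, add_zero]
  have hoff : ∑ v ∈ offPath D p, (deg T v : ℝ) / (ecc T v : ℝ) ≤
      ∑ i ∈ B, 1 / ((level D i : ℝ) + 1) := by
    have h1 : ∀ v ∈ offPath D p, deg T v = 1 := fun v hv => by
      have := one_le_deg hT.connected hV v
      have := hdegoff v hv
      omega
    rw [heq, Finset.sum_image hqinj]
    refine Finset.sum_le_sum fun i hi => ?_
    have hle : (level D i : ℝ) + 1 ≤ ecc T (q i) := by
      exact_mod_cast level_add_one_le_ecc hT hp.toIsGeodesic (mem_branchIndices.1 hi).1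
        (hq i hi).1 (hq i hi).2
    rw [h1 _ (hq i hi).2, Nat.cast_one]
    gcongr
  rw [cei, sum_eq_sum_path_add_sum_offPath hT.connected hp.toIsGeodesic]
  simp only [edgeWeight, Finset.sum_add_distrib]
  linarith

end Bounds

/-! ### Greedy sets of positions -/

/-- A set of inner positions of a path of length `D` that prefers large eccentricities. -/
structure IsGreedySet (D : ℕ) (S : Finset ℕ) : Prop where
  subset : S ⊆ Ioo 0 D
  mem_of_lt : ∀ j ∈ S, ∀ i ∈ Ioo 0 D, level D j < level D i → i ∈ S

theorem one_le_level {D i : ℕ} (hi : i ∈ Ioo 0 D) : 1 ≤ level D i := by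
  have := Finset.mem_Ioo.1 hi
  simp only [level]
  omega

theorem eq_or_eq_sub_of_level_eq {D i j : ℕ} (hi : i ≤ D) (hj : j ≤ D)
    (h : level D i = level D j) : i = j ∨ i = D - j := by
  simp only [level] at h
  omega

theorem level_sub {D i : ℕ} (hi : i ≤ D) : level D (D - i) = level D i := by
  simp only [level]
  omega

section Greedy

variable {D : ℕ} {S S' : Finset ℕ}

theorem IsGreedySet.level_le (hS : IsGreedySet D S) (hS' : S' ⊆ Ioo 0 D) {i j : ℕ}
    (hi : i ∈ S \ S') (hj : j ∈ S' \ S) : level D j ≤ level D i := by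
  by_contra! h
  exact (Finset.mem_sdiff.1 hj).2
    (hS.mem_of_lt i (Finset.mem_sdiff.1 hi).1 j (hS' (Finset.mem_sdiff.1 hj).1) h)

theorem IsGreedySet.eq_image_of_sdiff_eq (hS : IsGreedySet D S) (hcard : S.card = S'.card)
    {i : ℕ} (h₁ : S \ S' = {i}) (h₂ : S' \ S = {D - i}) : S' = S.image (D - ·) := by
  have hi : i ∈ S := (Finset.mem_sdiff.1 (h₁ ▸ Finset.mem_singleton_self i)).1
  have hi' := Finset.mem_sdiff.1 (h₂ ▸ Finset.mem_singleton_self (D - i))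
  have hiD := Finset.mem_Ioo.1 (hS.subset hi)
  have hmem : ∀ x ∈ S, x ≠ i → x ∈ S' := fun x hx hne => by
    by_contra h
    exact hne (Finset.mem_singleton.1 (h₁ ▸ Finset.mem_sdiff.2 ⟨hx, h⟩))
  have hinj : Set.InjOn (D - ·) (S : Set ℕ) := fun x hx y hy h => by
    have := Finset.mem_Ioo.1 (hS.subset hx)
    have := Finset.mem_Ioo.1 (hS.subset hy)
    simp only at h
    omega
  refine (Finset.eq_of_subset_of_card_le (Finset.image_subset_iff.2 fun x hx => ?_)
    (by rw [Finset.card_image_of_injOn hinj, hcard])).symm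
  by_cases hxi : x = i
  · exact hxi ▸ hi'.1
  have hxD := Finset.mem_Ioo.1 (hS.subset hx)
  have hx' : x ≠ D - i := fun h => hi'.2 (h ▸ hx)
  rcases lt_trichotomy (level D x) (level D i) with h | h | h
  · exact absurd (hS.mem_of_lt x hx (D - i) (by simp; omega) (by rwa [level_sub (by omega)])) hi'.2
  · rcases eq_or_eq_sub_of_level_eq hxD.2.le hiD.2.le h with h | h
    exacts [absurd h hxi, absurd h hx']
  · exact hmem _ (hS.mem_of_lt i hi (D - x) (by simp; omega) (by rwa [level_sub (by omega)]))
      (by omega)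

/-- Greedy sets minimise the total edge weight, uniquely up to reflection. -/
theorem IsGreedySet.sum_edgeWeight_le (hS : IsGreedySet D S) (hS' : S' ⊆ Ioo 0 D)
    (hcard : S.card = S'.card) :
    ∑ i ∈ S, edgeWeight (level D i) ≤ ∑ i ∈ S', edgeWeight (level D i) ∧
    (∑ i ∈ S', edgeWeight (level D i) = ∑ i ∈ S, edgeWeight (level D i) →
      S' = S ∨ S' = S.image (D - ·)) := by
  have hcard' : (S \ S').card = (S' \ S).card := Finset.card_sdiff_comm hcard
  rcases (S \ S').eq_empty_or_nonempty with hempty | hne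
  · have : S = S' :=
      Finset.eq_of_subset_of_card_le (Finset.sdiff_eq_empty_iff_subset.1 hempty) hcard.ge
    subst this
    simp
  obtain ⟨m, hm, hmin⟩ := Finset.exists_min_image (S \ S') (level D) hne
  have hmD : m ∈ Ioo 0 D := hS.subset (Finset.mem_sdiff.1 hm).1
  set w := edgeWeight (level D m)
  have hleft : ∀ i ∈ S \ S', edgeWeight (level D i) ≤ w := fun i hi =>
    edgeWeight_le (one_le_level hmD) (hmin i hi)
  have hright : ∀ j ∈ S' \ S, w ≤ edgeWeight (level D j) := fun j hj =>
    edgeWeight_le (one_le_level (hS' (Finset.mem_sdiff.1 hj).1)) (hS.level_le hS' hm hj)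
  have h₁ : ∑ i ∈ S \ S', edgeWeight (level D i) ≤ ∑ _i ∈ S \ S', w := Finset.sum_le_sum hleft
  have h₂ : ∑ _j ∈ S' \ S, w ≤ ∑ j ∈ S' \ S, edgeWeight (level D j) := Finset.sum_le_sum hright
  have h₃ : ∑ _i ∈ S \ S', w = ∑ _j ∈ S' \ S, w := by
    rw [Finset.sum_const, Finset.sum_const, hcard']
  have h₄ := Finset.sum_sdiff_sub_sum_sdiff (s₁ := S) (s₂ := S')
    (f := fun i => edgeWeight (level D i))
  refine ⟨by linarith, fun heq => Or.inr ?_⟩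
  have e₁ := (Finset.sum_eq_sum_iff_of_le hleft).1 (by linarith)
  have e₂ := (Finset.sum_eq_sum_iff_of_le hright).1 (by linarith)
  have hmi := Finset.mem_Ioo.1 hmD
  have hmem₂ : ∀ j ∈ S' \ S, j = D - m := fun j hj => by
    have hj' := Finset.mem_sdiff.1 hj
    have hjD := hS' hj'.1
    have := edgeWeight_inj (one_le_level hjD) (one_le_level hmD) (e₂ j hj).symm
    rcases eq_or_eq_sub_of_level_eq (Finset.mem_Ioo.1 hjD).2.le hmi.2.le this with rfl | h
    · exact absurd (Finset.mem_sdiff.1 hm).1 hj'.2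
    · exact h
  have hne' : (S' \ S).Nonempty := Finset.card_pos.1 (hcard' ▸ Finset.card_pos.2 hne)
  have hs₂ : S' \ S = {D - m} := Finset.eq_singleton_iff_nonempty_unique_mem.2 ⟨hne', hmem₂⟩
  have hs₁ : S \ S' = {m} := by
    rw [hs₂, Finset.card_singleton] at hcard'
    obtain ⟨x, hx⟩ := Finset.card_eq_one.1 hcard'
    rw [hx] at hm ⊢
    rw [Finset.mem_singleton.1 hm]
  exact hS.eq_image_of_sdiff_eq hcard hs₁ hs₂

end Greedy

/-- The total edge weight of a greedy set on a path of length `D + t` is at most that of any set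
on a path of length `D` together with `b ≤ t` outermost edges. -/
theorem IsGreedySet.sum_edgeWeight_add_le {D t b : ℕ} {S B : Finset ℕ} (hD : 1 ≤ D) (hb : b ≤ t)
    (hS : IsGreedySet (D + t) S) (hB : B ⊆ Ioo 0 D) (hcard : S.card = B.card + b) :
    ∑ i ∈ S, edgeWeight (level (D + t) i) ≤
      ∑ i ∈ B, edgeWeight (level D i) + b * edgeWeight D := by
  have hdisj : Disjoint (B.image (· + t)) (Icc 1 b) := by
    refine Finset.disjoint_left.2 fun x hx hx' => ?_
    obtain ⟨i, hi, rfl⟩ := Finset.mem_image.1 hx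
    have := Finset.mem_Ioo.1 (hB hi)
    have := Finset.mem_Icc.1 hx'
    omega
  have hinj : Set.InjOn (· + t) (B : Set ℕ) := fun x _ y _ h => Nat.add_right_cancel h
  refine ((hS.sum_edgeWeight_le (S' := B.image (· + t) ∪ Icc 1 b) ?_ ?_).1).trans ?_
  · refine Finset.union_subset (Finset.image_subset_iff.2 fun i hi => ?_) fun i hi => ?_
    · have := Finset.mem_Ioo.1 (hB hi)
      simp
      omega
    · have := Finset.mem_Icc.1 hi
      simp
      omega
  · rw [Finset.card_union_of_disjoint hdisj, Finset.card_image_of_injOn hinj, hcard]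
    simp
  · rw [Finset.sum_union hdisj, Finset.sum_image hinj, ← nsmul_eq_mul]
    refine add_le_add (Finset.sum_le_sum fun i hi => ?_)
      ((Finset.sum_le_card_nsmul _ _ (edgeWeight D) fun i hi => ?_).trans_eq (by simp))
    · refine edgeWeight_le (one_le_level (hB hi)) ?_
      have := Finset.mem_Ioo.1 (hB hi)
      simp only [level]
      omega
    · refine edgeWeight_le hD ?_
      have := Finset.mem_Icc.1 hi
      simp only [level]
      omega

/-! ### Isomorphisms -/

section Iso

theorem SimpleGraph.Iso.dist_eq {W : Type*} {T : SimpleGraph V} {F : SimpleGraph W}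
    (hT : T.Connected) (e : T ≃g F) (u v : V) : F.dist (e u) (e v) = T.dist u v := by
  have hF : F.Connected := e.connected_iff.1 hT
  apply le_antisymm
  · obtain ⟨w, hw⟩ := hT.exists_walk_length_eq_dist u v
    rw [← hw, ← Walk.length_map e.toHom w]
    exact dist_le _
  · obtain ⟨w, hw⟩ := hF.exists_walk_length_eq_dist (e u) (e v)
    rw [← hw, ← Walk.length_map e.symm.toHom w]
    refine (le_of_eq ?_).trans (dist_le _)
    simp

theorem cei_eq_of_iso {W : Type*} [Fintype V] [Fintype W] {T : SimpleGraph V} {F : SimpleGraph W}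
    (hT : T.Connected) (e : T ≃g F) : cei T = cei F := by
  classical
  refine Fintype.sum_equiv e.toEquiv _ _ fun u => ?_
  have hdeg : deg T u = deg F (e u) :=
    Finset.card_equiv e.toEquiv fun v => by simpa using e.map_adj_iff.symm
  have hecc : ecc T u = ecc F (e u) := by
    refine le_antisymm (ecc_le_iff.2 fun v => ?_) (ecc_le_iff.2 fun v => ?_)
    · rw [← e.dist_eq hT]
      exact dist_le_ecc_s11 _ _
    · rw [← e.apply_symm_apply v, e.dist_eq hT]
      exact dist_le_ecc_s11 _ _
  change (deg T u : ℝ) / (ecc T u : ℝ) = (deg F (e u) : ℝ) / (ecc F (e u) : ℝ)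
  rw [hdeg, hecc]

/-- `T` consists of the path `p 0, …, p D` and one pendant vertex `q s` at `p s` for `s ∈ B`. -/
structure IsCaterpillarOn (T : SimpleGraph V) (D : ℕ) (B : Finset ℕ) (p q : ℕ → V) : Prop where
  adj_path : ∀ i < D, T.Adj (p i) (p (i + 1))
  adj_pendant : ∀ s ∈ B, T.Adj (p s) (q s)
  le_of_mem : ∀ s ∈ B, s ≤ D
  bijective : Function.Bijective
    (Sum.elim (fun i : Fin (D + 1) => p i) (fun s : B => q s) : Fin (D + 1) ⊕ B → V)

theorem IsCaterpillarOn.connected {T : SimpleGraph V} {D : ℕ} {B : Finset ℕ} {p q : ℕ → V}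
    (hT : IsCaterpillarOn T D B p q) : T.Connected := by
  have hpath : ∀ i ≤ D, T.Reachable (p 0) (p i) := by
    intro i hi
    induction i with
    | zero => exact Reachable.refl _
    | succ i ih => exact (ih (by omega)).trans (hT.adj_path i hi).reachable
  have hall : ∀ v, T.Reachable (p 0) v := by
    intro v
    obtain ⟨i | s, rfl⟩ := hT.bijective.2 v
    · exact hpath i (Nat.lt_succ_iff.1 i.2)
    · exact (hpath s (hT.le_of_mem s s.2)).trans (hT.adj_pendant s s.2).reachable
  exact (connected_iff _).2 ⟨fun u v => (hall u).symm.trans (hall v), ⟨p 0⟩⟩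

/-- Trees that are the same caterpillar are isomorphic. -/
theorem IsCaterpillarOn.nonempty_iso {W : Type*} {T : SimpleGraph V} {F : SimpleGraph W}
    (hT : T.IsTree) (hF : F.IsTree) {D : ℕ} {B : Finset ℕ} {p q : ℕ → V} {p' q' : ℕ → W}
    (h : IsCaterpillarOn T D B p q) (h' : IsCaterpillarOn F D B p' q') : Nonempty (T ≃g F) := by
  let φ := Equiv.ofBijective _ h.bijective
  let ψ := Equiv.ofBijective _ h'.bijective
  let e : V ≃ W := φ.symm.trans ψ
  have hp : ∀ i ≤ D, e (p i) = p' i := fun i hi => by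
    have : p i = φ (Sum.inl ⟨i, Nat.lt_succ_of_le hi⟩) := rfl
    simp only [e, this, Equiv.trans_apply, Equiv.symm_apply_apply]
    rfl
  have hq : ∀ s ∈ B, e (q s) = q' s := fun s hs => by
    have : q s = φ (Sum.inr ⟨s, hs⟩) := rfl
    simp only [e, this, Equiv.trans_apply, Equiv.symm_apply_apply]
    rfl
  have hH : IsCaterpillarOn (T ⊓ F.comap e) D B p q :=
    { adj_path := fun i hi => ⟨h.adj_path i hi, by
        rw [comap_adj, hp i hi.le, hp (i + 1) hi]
        exact h'.adj_path i hi⟩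
      adj_pendant := fun s hs => ⟨h.adj_pendant s hs, by
        rw [comap_adj, hp s (h.le_of_mem s hs), hq s hs]
        exact h'.adj_pendant s hs⟩
      le_of_mem := h.le_of_mem
      bijective := h.bijective }
  have hle : T ≤ F.comap e :=
    ((isTree_iff_minimal_connected.1 hT).le_of_le hH.connected inf_le_left).trans inf_le_right
  have htree : (F.comap e).IsTree := (SimpleGraph.Iso.comap e F).isTree_iff.2 hF
  have hge := (isTree_iff_minimal_connected.1 htree).le_of_le hT.connected hle
  rw [le_antisymm hle hge]
  exact ⟨SimpleGraph.Iso.comap e F⟩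

theorem IsDiametral.exists_isCaterpillarOn [Fintype V] {T : SimpleGraph V} (hT : T.IsTree)
    (hV : 2 ≤ Fintype.card V) {D : ℕ} {p : ℕ → V} (hp : IsDiametral T D p)
    (hcard : (offPath D p).card = (branchIndices T D p).card) :
    ∃ q, IsCaterpillarOn T D (branchIndices T D p) p q := by
  classical
  obtain ⟨q, hq, hqinj⟩ := hp.exists_pendant hT hV
  refine ⟨q, hp.adj, fun s hs => (hq s hs).1, fun s hs => (mem_branchIndices.1 hs).1, ?_⟩
  rw [Fintype.bijective_iff_injective_and_card]
  refine ⟨Function.Injective.sumElim ?_ ?_ ?_, ?_⟩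
  · exact fun i j h => Fin.ext (hp.injOn hT.connected (Nat.lt_succ_iff.1 i.2)
      (Nat.lt_succ_iff.1 j.2) h)
  · exact fun s t h => Subtype.ext (hqinj s.2 t.2 h)
  · exact fun i s h => mem_offPath.1 (hq s s.2).2 i (Nat.lt_succ_iff.1 i.2) h.symm
  · rw [card_eq_add_card_offPath hT.connected hp.toIsGeodesic, hcard]
    simp

end Iso

/-! ### The greedy caterpillar -/

/-- A path with inner vertices in a tree can be prolonged at both ends if these are not leaves. -/
theorem exists_isGeodesic_of_spine [Fintype V] {T : SimpleGraph V} (hT : T.IsTree) {k : ℕ}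
    (hk : 1 ≤ k) {z : ℕ → V} (hadj : ∀ i, i + 1 < k → T.Adj (z i) (z (i + 1)))
    (hne : ∀ i, i + 2 < k → z i ≠ z (i + 2)) (hstart : 2 ≤ deg T (z 0))
    (hend : 2 ≤ deg T (z (k - 1))) :
    ∃ p, IsGeodesic T (k + 1) p ∧ ∀ i < k, p (i + 1) = z i := by
  obtain ⟨k, rfl⟩ := Nat.exists_eq_add_of_le' hk
  obtain ⟨a, ha, ha'⟩ := exists_adj_ne_of_two_le_deg hstart (z 1)
  obtain ⟨b, hb, hb'⟩ := exists_adj_ne_of_two_le_deg hend (if k = 0 then a else z (k - 1))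
  simp only [Nat.add_sub_cancel] at hb
  let p : ℕ → V := fun i => if i = 0 then a else if i = k + 2 then b else z (i - 1)
  have hmid : ∀ i < k + 1, p (i + 1) = z i := fun i hi => by
    simp only [p]
    rw [if_neg (by omega), if_neg (by omega), Nat.add_sub_cancel]
  have hp0 : p 0 = a := if_pos rfl
  have hpk : p (k + 2) = b := by simp [p]
  refine ⟨p, IsGeodesic.of_adj hT (fun i hi => ?_) (fun i hi => ?_), hmid⟩
  · rcases Nat.eq_zero_or_pos i with rfl | h0
    · rw [hp0, hmid 0 (by omega)]
      exact ha.symm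
    · obtain ⟨i, rfl⟩ := Nat.exists_eq_add_one.2 h0
      rw [hmid i (by omega)]
      rcases Nat.lt_or_ge i k with h | h
      · rw [hmid (i + 1) (by omega)]
        exact hadj i (by omega)
      · obtain rfl : i = k := by omega
        rw [hpk]
        exact hb
  · rcases Nat.eq_zero_or_pos i with rfl | h0
    · rcases Nat.eq_zero_or_pos k with rfl | hk
      · rw [hp0, hpk]
        simpa using hb'.symm
      · rw [hp0, hmid 1 (by omega)]
        exact ha'
    · obtain ⟨i, rfl⟩ := Nat.exists_eq_add_one.2 h0
      rw [hmid i (by omega)]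
      rcases Nat.lt_or_ge (i + 1) k with h | h
      · rw [hmid (i + 2) (by omega)]
        exact hne i (by omega)
      · obtain rfl : k = i + 1 := by omega
        rw [hpk]
        simpa using hb'.symm

theorem branchCount_eq_of_hasDegSeq_dF [Fintype V] {F : SimpleGraph V} {n r : ℕ}
    (hrn : r ≤ n) (hF : hasDegSeq F (dF n r)) : branchCount F = r := by
  obtain ⟨e, he⟩ := hF
  have h₁ : branchCount F = ({i : Fin n | (i : ℕ) < r} : Finset (Fin n)).card := by
    refine Finset.card_equiv e fun v => ?_
    simp only [Finset.mem_filter, Finset.mem_univ, true_and, he, dF]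
    split_ifs <;> omega
  rw [h₁, Fin.card_filter_val_lt, min_eq_right hrn]

/-- A greedy caterpillar has a diametral path whose branching positions form a greedy set. -/
theorem IsGreedyCaterpillar.exists_isDiametral [Fintype V] {F : SimpleGraph V} (hF : F.IsTree)
    {n r : ℕ} (hr : 1 ≤ r) (hrn : 2 * r + 2 ≤ n) (hcard : Fintype.card V = n)
    (hbr : branchCount F = r) (hgc : IsGreedyCaterpillar F (n - r - 2)) :
    ∃ p, IsDiametral F (n - r - 1) p ∧ (offPath (n - r - 1) p).card = r ∧
      (branchIndices F (n - r - 1) p).card = r ∧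
      IsGreedySet (n - r - 1) (branchIndices F (n - r - 1) p) := by
  have hV : 2 ≤ Fintype.card V := by omega
  obtain ⟨k, hk⟩ : ∃ k, k = n - r - 2 := ⟨_, rfl⟩
  have hkD : n - r - 1 = k + 1 := by omega
  rw [← hk] at hgc
  rw [hkD]
  obtain ⟨z, hzadj, -, hzdeg, hzgreedy⟩ := hgc
  have hk1 : 1 ≤ k := by omega
  let y : ℕ → V := fun i => if h : i < k then z ⟨i, h⟩ else z ⟨0, hk1⟩
  have hy : ∀ i (h : i < k), y i = z ⟨i, h⟩ := fun i h => dif_pos h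
  obtain ⟨p, hp, hpy⟩ := exists_isGeodesic_of_spine hF hk1 (z := y)
    (fun i hi => by rw [hy i (by omega), hy (i + 1) hi]; exact hzadj i hi)
    (fun i hi => by
      rw [hy i (by omega), hy (i + 2) hi]
      intro h
      have := congrArg Fin.val (z.injective h)
      simp at this)
    (by rw [hy 0 hk1]; exact hzdeg _) (by rw [hy (k - 1) (by omega)]; exact hzdeg _)
  have hdiam : IsDiametral F (k + 1) p := by
    refine ⟨hp, fun u v => ?_⟩
    obtain ⟨D, p', hp'⟩ := _root_.exists_isDiametral hF
    have h₁ := hp'.branchCount_add_le hF hV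
    have h₂ := card_eq_add_card_offPath hF.connected hp'.toIsGeodesic
    have h₃ := hp'.dist_le u v
    omega
  have h₁ := hdiam.branchCount_add_le hF hV
  have h₂ := card_eq_add_card_offPath hF.connected hp
  have h₃ := branchCount_eq hF.connected hp
  refine ⟨p, hdiam, by omega, by omega, fun i hi => ?_, fun j hj i hi hlt => ?_⟩
  · exact Finset.mem_Ioo.2 (hdiam.pos_lt_of_mem_branchIndices hF hV hi)
  · obtain ⟨hj0, hjD⟩ := hdiam.pos_lt_of_mem_branchIndices hF hV hj
    obtain ⟨hi0, hiD⟩ := Finset.mem_Ioo.1 hi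
    obtain ⟨-, hjdeg⟩ := mem_branchIndices.1 hj
    obtain ⟨i, rfl⟩ := Nat.exists_eq_add_one.2 hi0
    obtain ⟨j, rfl⟩ := Nat.exists_eq_add_one.2 hj0
    refine mem_branchIndices.2 ⟨hiD.le, ?_⟩
    rw [hpy j (by omega), hy j (by omega)] at hjdeg
    rw [hpy i (by omega), hy i (by omega)]
    refine hjdeg.trans (hzgreedy _ _ ?_)
    simp only [level] at hlt ⊢
    omega

theorem branchIndices_reverse [Fintype V] {T : SimpleGraph V} {D : ℕ} {p : ℕ → V} :
    branchIndices T D (fun i => p (D - i)) = (branchIndices T D p).image (D - ·) := by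
  ext i
  simp only [mem_branchIndices, Finset.mem_image]
  constructor
  · rintro ⟨hi, hd⟩
    exact ⟨D - i, ⟨by omega, hd⟩, by omega⟩
  · rintro ⟨j, ⟨hj, hd⟩, rfl⟩
    exact ⟨by omega, by rwa [Nat.sub_sub_self hj]⟩

/-- if `T` is a tree on `n` vertices with exactly `r` branching
vertices, `1 ≤ r ≤ n/2 - 1`, and `F = F(n,r)` is the greedy caterpillar with degree
sequence `(3,…,3,2,…,2,1,…,1)` (`r` threes), then `ξ^{ce}(T) ≥ ξ^{ce}(F(n,r))`, with
equality iff `T ≅ F(n,r)`. -/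
theorem cei_ge_F_of_branchCount {n r : ℕ} (hr : 1 ≤ r) (hrn : 2 * r + 2 ≤ n)
    [Fintype V] (hcard : Fintype.card V = n)
    (T : SimpleGraph V) (hT : T.IsTree) (hbr : branchCount T = r)
    {W : Type*} [Fintype W] (F : SimpleGraph W) (hF : F.IsTree)
    (hdF : hasDegSeq F (dF n r)) (hgc : IsGreedyCaterpillar F (n - r - 2)) :
    cei F ≤ cei T ∧ (cei T = cei F ↔ Nonempty (T ≃g F)) := by
  classical
  obtain ⟨eF, -⟩ := id hdF
  have hcardW : Fintype.card W = n := by simpa using Fintype.card_congr eF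
  have hV : 2 ≤ Fintype.card V := by omega
  have hW : 2 ≤ Fintype.card W := by omega
  have hbrF := branchCount_eq_of_hasDegSeq_dF (by omega) hdF
  obtain ⟨pF, hpF, hoffF, hBF, hgreedy⟩ := hgc.exists_isDiametral hF hr hrn hcardW hbrF
  obtain ⟨D, p, hp⟩ := exists_isDiametral hT
  have hoff := hp.branchCount_add_le hT hV
  have hcardV := card_eq_add_card_offPath hT.connected hp.toIsGeodesic
  have hbrT := branchCount_eq hT.connected hp.toIsGeodesic
  set b := ((offPath D p).filter (fun v => 3 ≤ deg T v)).card
  set B := branchIndices T D p with hB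
  obtain ⟨t, ht⟩ : ∃ t, (offPath D p).card = r + t := ⟨_, (Nat.add_sub_of_le (by omega)).symm⟩
  have hDF : n - r - 1 = D + t := by omega
  rw [hDF] at hpF hoffF hBF hgreedy
  have hD : 2 ≤ D := by
    obtain ⟨v, hv⟩ := Finset.card_pos.1 (show 0 < branchCount T by omega)
    have h₁ := hp.ecc_lt hT (v := v) (by have := (Finset.mem_filter.1 hv).2; omega)
    have h₂ := one_le_ecc hT.connected hV v
    omega
  have hBsub : B ⊆ Ioo 0 D := fun i hi =>
    Finset.mem_Ioo.2 (hp.pos_lt_of_mem_branchIndices hT hV hi)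
  have lower := hp.le_cei hT hV
  have upper := hpF.cei_le hF hW (hoffF.trans hBF.symm)
  have hexcess : ((offPath D p).card - (branchIndices T D p).card : ℝ) = t + b := by
    rw [ht, ← hB]
    have : (r : ℝ) = B.card + b := by exact_mod_cast (show r = B.card + b by omega)
    push_cast
    linarith
  rw [hexcess, ← hB] at lower
  have hpath := pathCei_add_le (show 1 ≤ D by omega) t
  have hsum := hgreedy.sum_edgeWeight_add_le (b := b) (show 1 ≤ D by omega) (by omega) hBsub
    (by omega)
  have hw : edgeWeight D < edgeWeight (D - 1) := edgeWeight_lt (by omega) (by omega)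
  have hextra : ((t : ℝ) + b) * edgeWeight D ≤ ((t : ℝ) + b) * edgeWeight (D - 1) := by gcongr
  refine ⟨by linarith, fun heq => ?_, fun ⟨e⟩ => cei_eq_of_iso hT.connected e⟩
  have ht0 : t = 0 := by
    by_contra h
    have hpos : (0 : ℝ) < (t : ℝ) + b := by
      have : (0 : ℝ) < t := by exact_mod_cast Nat.pos_of_ne_zero h
      positivity
    have := mul_lt_mul_of_pos_left hw hpos
    linarith
  subst ht0
  have hb0 : b = 0 := by omega
  rw [add_zero] at hpF hoffF hBF hgreedy upper
  rw [hb0, Nat.cast_zero, add_zero, zero_mul, add_zero] at lower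
  have hcards : (branchIndices F D pF).card = B.card := by omega
  obtain ⟨hle, hunique⟩ := hgreedy.sum_edgeWeight_le hBsub hcards
  obtain ⟨q, hq⟩ := hp.exists_isCaterpillarOn hT hV (by rw [← hB]; omega)
  rcases hunique (by linarith) with h | h
  · obtain ⟨qF, hqF⟩ := hpF.exists_isCaterpillarOn hF hW (by omega)
    rw [← hB, h] at hq
    exact hq.nonempty_iso hT hF hqF
  · have hoffR := card_eq_add_card_offPath hF.connected hpF.reverse.toIsGeodesic
    obtain ⟨qF, hqF⟩ := hpF.reverse.exists_isCaterpillarOn hF hW (by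
      rw [branchIndices_reverse, ← h]
      omega)
    rw [branchIndices_reverse, ← h] at hqF
    exact hq.nonempty_iso hT hF hqF
end
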